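/- arXiv:math/0310039 — 3 statements merged into one kernel-verified Lean document; each statement's English description precedes it below -/
import Mathlib

section
/- Control on the maximal velocity (Lemma 2.4): There is a constant C depending only on d such that for every t ≥ 0, K(t) ≤ K(0) + C t + C ε Ē(t) + C ∫₀^t Ē(s) ds. -/
open MeasureTheory Metric Set Filter
open scoped ENNReal

noncomputable section

abbrev Euc (d : ℕ) := EuclideanSpace ℝ (Fin d)
abbrev Phase (d : ℕ) := Euc d × Euc d

/-- Closed ball for the coordinatewise sup norm on `ℝ^{2d}`. -/
def Binf {d : ℕ} (z : Phase d) (η : ℝ) : Set (Phase d) :=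
  {p | (∀ k, |p.1 k - z.1 k| ≤ η) ∧ ∀ k, |p.2 k - z.2 k| ≤ η}

/-- Discrete `L^∞` norm at scale `η` of a measure on the phase space. -/
def discNorm {d : ℕ} (μ : Measure (Phase d)) (η : ℝ) : ℝ :=
  ((2*η)^(2*d))⁻¹ * ⨆ z : Phase d, (μ (Binf z η)).toReal

/-- Empirical measure of the particle configuration at time `t`. -/
def empMeas {d N : ℕ} (X V : Fin N → ℝ → Euc d) (t : ℝ) : Measure (Phase d) :=
  ((N : ℝ≥0∞))⁻¹ • ∑ i : Fin N, Measure.dirac (X i t, V i t)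

/-- Mean-field force felt by particle `i` at time `t`. -/
def fieldAt {d N : ℕ} (F : Euc d → Euc d) (X : Fin N → ℝ → Euc d) (i : Fin N) (t : ℝ) :
    Euc d :=
  (N : ℝ)⁻¹ • ∑ j ∈ Finset.univ.erase i, F (X i t - X j t)

/-- `R(T)`: maximal position on `[0,T]`. -/
def Rmax {d N : ℕ} (X : Fin N → ℝ → Euc d) (T : ℝ) : ℝ :=
  ⨆ (i : Fin N) (t : Icc (0:ℝ) T), ‖X i (t : ℝ)‖

/-- `K(T)`: maximal velocity on `[0,T]`. -/
def Kmax {d N : ℕ} (V : Fin N → ℝ → Euc d) (T : ℝ) : ℝ :=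
  ⨆ (i : Fin N) (t : Icc (0:ℝ) T), ‖V i (t : ℝ)‖

/-- `m(T)`: inverse minimal phase-space separation, normalized by `ε`. -/
def msep {d N : ℕ} (X V : Fin N → ℝ → Euc d) (ε T : ℝ) : ℝ :=
  ⨆ (i : Fin N) (j : Fin N) (_ : i ≠ j) (t : Icc (0:ℝ) T),
    ε / (‖X i (t : ℝ) - X j (t : ℝ)‖ + ‖V i (t : ℝ) - V j (t : ℝ)‖)

/-- `Ē(T)`: supremum of time averages of the force over windows of length `ε`. -/
def Ebar {d N : ℕ} (F : Euc d → Euc d) (X : Fin N → ℝ → Euc d) (ε T : ℝ) : ℝ :=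
  if T < ε then ⨆ i : Fin N, ε⁻¹ * ∫ s in (0:ℝ)..T, ‖fieldAt F X i s‖
  else ⨆ (i : Fin N) (t : Icc (0:ℝ) (T - ε)),
    ε⁻¹ * ∫ s in (t : ℝ)..((t : ℝ) + ε), ‖fieldAt F X i s‖

/-- `ΔĒ(T)`: supremum of time averages of the discretized derivative of the force. -/
def dEbar {d N : ℕ} (F : Euc d → Euc d) (X : Fin N → ℝ → Euc d) (ε β T : ℝ) : ℝ :=
  if T < ε then
    ⨆ (i : Fin N) (j : Fin N) (_ : i ≠ j),
      ε⁻¹ * ∫ s in (0:ℝ)..T,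
        ‖fieldAt F X i s - fieldAt F X j s‖ / (ε ^ β + ‖X i s - X j s‖)
  else
    ⨆ (i : Fin N) (j : Fin N) (_ : i ≠ j) (t : Icc (0:ℝ) (T - ε)),
      ε⁻¹ * ∫ s in (t : ℝ)..((t : ℝ) + ε),
        ‖fieldAt F X i s - fieldAt F X j s‖ / (ε ^ β + ‖X i s - X j s‖)

/-- The discretization scale `ε = R(0)/N^{1/(2d)}`. -/
def epsOf {d N : ℕ} (X : Fin N → ℝ → Euc d) : ℝ :=
  Rmax X 0 / (N : ℝ) ^ (2*(d:ℝ))⁻¹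

lemma intervalIntegrable_fieldAt {d N : ℕ} {α C₀ : ℝ} {F : Euc d → Euc d}
    {X V : Fin N → ℝ → Euc d}
    (hF : ∀ x : Euc d, x ≠ 0 → ‖F x‖ ≤ C₀ / ‖x‖ ^ α)
    (hne : ∀ i j : Fin N, i ≠ j → ∀ t : ℝ, 0 ≤ t → X i t ≠ X j t)
    (hX : ∀ i : Fin N, ∀ t : ℝ, 0 ≤ t → HasDerivAt (X i) (V i t) t)
    (hV : ∀ i : Fin N, ∀ t : ℝ, 0 ≤ t → HasDerivAt (V i) (fieldAt F X i t) t)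
    (i : Fin N) {a b : ℝ} (ha : 0 ≤ a) (hb : 0 ≤ b) :
    IntervalIntegrable (fieldAt F X i) volume a b := by
  have hpos : ∀ s ∈ uIcc a b, 0 ≤ s := fun s hs => (le_min ha hb).trans hs.1
  have hpair : ∀ j, ∃ B : ℝ, ∀ s ∈ uIcc a b, i ≠ j → ‖F (X i s - X j s)‖ ≤ B := by
    intro j
    by_cases hij : i = j
    · exact ⟨0, fun s _ h => absurd hij h⟩
    · have hcont : ContinuousOn (fun s => C₀ / ‖X i s - X j s‖ ^ α) (uIcc a b) := by
        intro s hs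
        have hd : ‖X i s - X j s‖ ≠ 0 :=
          norm_ne_zero_iff.2 (sub_ne_zero.2 (hne i j hij s (hpos s hs)))
        have hc : ContinuousAt (fun s => ‖X i s - X j s‖) s :=
          ((hX i s (hpos s hs)).continuousAt.sub (hX j s (hpos s hs)).continuousAt).norm
        refine ContinuousAt.continuousWithinAt
          (continuousAt_const.div (hc.rpow_const (Or.inl hd)) ?_)
        exact (Real.rpow_pos_of_pos (lt_of_le_of_ne (norm_nonneg _) hd.symm) α).ne'
      obtain ⟨B, hB⟩ := (isCompact_uIcc.image_of_continuousOn hcont).bddAbove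
      exact ⟨B, fun s hs _ => (hF _ (sub_ne_zero.2 (hne i j hij s (hpos s hs)))).trans
        (hB (mem_image_of_mem _ hs))⟩
  choose B hB using hpair
  have hbound : ∀ s ∈ uIcc a b,
      ‖fieldAt F X i s‖ ≤ (N : ℝ)⁻¹ * ∑ j ∈ Finset.univ.erase i, B j := by
    intro s hs
    rw [fieldAt, norm_smul, norm_inv, Real.norm_natCast]
    gcongr
    exact norm_sum_le_of_le _ fun j hj => hB j s hs (Finset.ne_of_mem_erase hj).symm
  have hderiv : EqOn (deriv (V i)) (fieldAt F X i) (uIoc a b) := fun s hs =>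
    (hV i s (hpos s (uIoc_subset_uIcc hs))).deriv
  refine (intervalIntegrable_const (c := (N : ℝ)⁻¹ * ∑ j ∈ Finset.univ.erase i, B j)).mono_fun
    ?_ ?_
  · refine (stronglyMeasurable_deriv (V i)).aestronglyMeasurable.congr ?_
    exact (ae_restrict_iff' measurableSet_uIoc).2 (Eventually.of_forall hderiv)
  · refine (ae_restrict_iff' measurableSet_uIoc).2 (Eventually.of_forall fun s hs => ?_)
    exact (hbound s (uIoc_subset_uIcc hs)).trans (le_abs_self _)

lemma Ebar_nonneg {d N : ℕ} (F : Euc d → Euc d) (X : Fin N → ℝ → Euc d) {ε T : ℝ}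
    (hε : 0 < ε) (hT : 0 ≤ T) : 0 ≤ Ebar F X ε T := by
  rw [Ebar]
  split_ifs
  · exact Real.iSup_nonneg fun i => mul_nonneg (inv_nonneg.2 hε.le)
      (intervalIntegral.integral_nonneg hT fun _ _ => norm_nonneg _)
  · exact Real.iSup_nonneg fun i => Real.iSup_nonneg fun t => mul_nonneg (inv_nonneg.2 hε.le)
      (intervalIntegral.integral_nonneg (by linarith) fun _ _ => norm_nonneg _)

lemma initial_average_le_Ebar {d N : ℕ} (F : Euc d → Euc d) (X : Fin N → ℝ → Euc d) {ε T : ℝ}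
    (hT : T < ε) (i : Fin N) :
    ε⁻¹ * ∫ s in (0:ℝ)..T, ‖fieldAt F X i s‖ ≤ Ebar F X ε T := by
  rw [Ebar, if_pos hT]
  exact le_ciSup (f := fun i : Fin N => ε⁻¹ * ∫ s in (0:ℝ)..T, ‖fieldAt F X i s‖)
    (finite_range _).bddAbove i

section

variable {d N : ℕ} {F : Euc d → Euc d} {X : Fin N → ℝ → Euc d}

lemma window_average_le_Ebar
    (hint : ∀ i, ∀ a b : ℝ, 0 ≤ a → 0 ≤ b → IntervalIntegrable (fieldAt F X i) volume a b)
    {ε T : ℝ} (hε : 0 < ε) (i : Fin N) {u : ℝ} (hu : 0 ≤ u) (huT : u + ε ≤ T) :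
    ε⁻¹ * ∫ s in u..(u + ε), ‖fieldAt F X i s‖ ≤ Ebar F X ε T := by
  rw [Ebar, if_neg (by linarith)]
  have hbdd : BddAbove (range fun t : Icc (0:ℝ) (T - ε) =>
      ε⁻¹ * ∫ s in (t : ℝ)..((t : ℝ) + ε), ‖fieldAt F X i s‖) := by
    refine ⟨ε⁻¹ * ∫ s in (0:ℝ)..T, ‖fieldAt F X i s‖, ?_⟩
    rintro _ ⟨⟨t, ht0, htT⟩, rfl⟩
    refine mul_le_mul_of_nonneg_left ?_ (inv_nonneg.2 hε.le)
    exact intervalIntegral.integral_mono_interval ht0 (by linarith) (by linarith)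
      (Eventually.of_forall fun _ => norm_nonneg _) (hint i 0 T le_rfl (by linarith)).norm
  exact (le_ciSup hbdd ⟨u, hu, by linarith⟩).trans
    (le_ciSup (f := fun i : Fin N => ⨆ t : Icc (0:ℝ) (T - ε),
      ε⁻¹ * ∫ s in (t : ℝ)..((t : ℝ) + ε), ‖fieldAt F X i s‖) (finite_range _).bddAbove i)

lemma monotoneOn_Ebar
    (hint : ∀ i, ∀ a b : ℝ, 0 ≤ a → 0 ≤ b → IntervalIntegrable (fieldAt F X i) volume a b)
    {ε : ℝ} (hε : 0 < ε) : MonotoneOn (Ebar F X ε) (Ici 0) := by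
  intro S hS T hT hST
  have hS : 0 ≤ S := hS
  have hT : 0 ≤ T := hT
  have hmono : ∀ i : Fin N, ∀ b, S ≤ b → ε⁻¹ * ∫ s in (0:ℝ)..S, ‖fieldAt F X i s‖ ≤
      ε⁻¹ * ∫ s in (0:ℝ)..b, ‖fieldAt F X i s‖ := fun i b hb =>
    mul_le_mul_of_nonneg_left (intervalIntegral.integral_mono_interval le_rfl hS hb
      (Eventually.of_forall fun _ => norm_nonneg _)
      (hint i 0 b le_rfl (hS.trans hb)).norm) (inv_nonneg.2 hε.le)
  by_cases h : S < ε
  · rw [Ebar, if_pos h]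
    refine Real.iSup_le (fun i => ?_) (Ebar_nonneg F X hε hT)
    by_cases h' : T < ε
    · exact (hmono i T hST).trans (initial_average_le_Ebar F X h' i)
    · refine (hmono i ε h.le).trans ?_
      simpa using window_average_le_Ebar hint hε i le_rfl (by linarith : 0 + ε ≤ T)
  · rw [Ebar, if_neg h]
    refine Real.iSup_le (fun i => Real.iSup_le (fun u => ?_) (Ebar_nonneg F X hε hT))
      (Ebar_nonneg F X hε hT)
    exact window_average_le_Ebar hint hε i u.2.1 (by linarith [u.2.2])

/-- Splitting `[0,u]` backwards into windows of length `ε`, each window being controlled by the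
integral of `Ē` over the next one. -/
lemma integral_norm_fieldAt_le
    (hint : ∀ i, ∀ a b : ℝ, 0 ≤ a → 0 ≤ b → IntervalIntegrable (fieldAt F X i) volume a b)
    {ε : ℝ} (hε : 0 < ε) (i : Fin N) {u : ℝ} (hu : 0 ≤ u) :
    ∫ s in (0:ℝ)..u, ‖fieldAt F X i s‖ ≤
      ε * Ebar F X ε u + ∫ s in (0:ℝ)..u, Ebar F X ε s := by
  have hmono := monotoneOn_Ebar hint hε
  have hEint : ∀ a b : ℝ, 0 ≤ a → 0 ≤ b → IntervalIntegrable (Ebar F X ε) volume a b :=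
    fun a b ha hb => (hmono.mono fun s hs => (le_min ha hb).trans hs.1).intervalIntegrable
  obtain ⟨n, hn⟩ := exists_nat_gt (u / ε)
  rw [div_lt_iff₀ hε] at hn
  induction n generalizing u with
  | zero => simp at hn; linarith
  | succ n ih =>
    by_cases h : u < ε
    · have h1 := (inv_mul_le_iff₀ hε).1 (initial_average_le_Ebar F X h i)
      have h2 : 0 ≤ ∫ s in (0:ℝ)..u, Ebar F X ε s :=
        intervalIntegral.integral_nonneg hu fun s hs => Ebar_nonneg F X hε hs.1
      linarith
    · have hv : 0 ≤ u - ε := by linarith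
      push_cast at hn
      have hprev := ih hv (by linarith)
      have hlast := (inv_mul_le_iff₀ hε).1
        (window_average_le_Ebar hint hε i hv (by linarith : u - ε + ε ≤ u))
      rw [sub_add_cancel] at hlast
      have hstep : ε * Ebar F X ε (u - ε) ≤ ∫ s in (u - ε)..u, Ebar F X ε s := by
        have := intervalIntegral.integral_mono_on (by linarith : u - ε ≤ u)
          (intervalIntegrable_const (c := Ebar F X ε (u - ε))) (hEint (u - ε) u hv hu)
          fun s hs => hmono hv (hv.trans hs.1) hs.1
        simpa using this
      rw [← intervalIntegral.integral_add_adjacent_intervals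
          (hint i 0 (u - ε) le_rfl hv).norm (hint i (u - ε) u hv hu).norm,
        ← intervalIntegral.integral_add_adjacent_intervals
          (hEint 0 (u - ε) le_rfl hv) (hEint (u - ε) u hv hu)]
      linarith

end

lemma norm_le_Kmax_zero {d N : ℕ} (V : Fin N → ℝ → Euc d) (i : Fin N) :
    ‖V i 0‖ ≤ Kmax V 0 := by
  have hfin : Finite (Icc (0:ℝ) 0) := by rw [Icc_self]; infer_instance
  exact (le_ciSup (f := fun t : Icc (0:ℝ) 0 => ‖V i (t : ℝ)‖) (finite_range _).bddAbove
    ⟨0, le_rfl, le_rfl⟩).trans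
    (le_ciSup (f := fun i : Fin N => ⨆ t : Icc (0:ℝ) 0, ‖V i (t : ℝ)‖)
      (finite_range _).bddAbove i)

/-- Control on the maximal velocity (Lemma 2.4): there is a constant `C` depending only
on `d` such that for every `t ≥ 0`,
`K(t) ≤ K(0) + C t + C ε Ē(t) + C ∫₀ᵗ Ē(s) ds`. -/
theorem maximal_velocity_control
    (d : ℕ) (hd : 1 ≤ d) :
    ∃ C : ℝ, 0 < C ∧
      ∀ (N : ℕ), 2 ≤ N →
        ∀ (α C₀ : ℝ) (F : Euc d → Euc d) (X V : Fin N → ℝ → Euc d) (ε : ℝ),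
          0 < α → α < 1 → 0 < C₀ →
          (∀ x : Euc d, x ≠ 0 → ‖F x‖ ≤ C₀ / ‖x‖ ^ α) →
          (∀ i j : Fin N, i ≠ j → ∀ t : ℝ, 0 ≤ t → X i t ≠ X j t) →
          (∀ i : Fin N, ∀ t : ℝ, 0 ≤ t → HasDerivAt (X i) (V i t) t) →
          (∀ i : Fin N, ∀ t : ℝ, 0 ≤ t → HasDerivAt (V i) (fieldAt F X i t) t) →
          ε = epsOf X → 0 < ε →
          ∀ t : ℝ, 0 ≤ t →
            Kmax V t ≤ Kmax V 0 + C * t + C * ε * Ebar F X ε t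
              + C * ∫ s in (0:ℝ)..t, Ebar F X ε s := by
  refine ⟨1, one_pos, ?_⟩
  intro N _ α C₀ F X V ε _ _ _ hF hne hX hV _ hε t ht
  have hint : ∀ i, ∀ a b : ℝ, 0 ≤ a → 0 ≤ b →
      IntervalIntegrable (fieldAt F X i) volume a b := fun i a b ha hb =>
    intervalIntegrable_fieldAt hF hne hX hV i ha hb
  have hK0 : 0 ≤ Kmax V 0 := Real.iSup_nonneg fun i => Real.iSup_nonneg fun s => norm_nonneg _
  have hE0 : 0 ≤ ε * Ebar F X ε t := mul_nonneg hε.le (Ebar_nonneg F X hε ht)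
  have hI0 : 0 ≤ ∫ s in (0:ℝ)..t, Ebar F X ε s :=
    intervalIntegral.integral_nonneg ht fun s hs => Ebar_nonneg F X hε hs.1
  have hnn : 0 ≤ Kmax V 0 + 1 * t + 1 * ε * Ebar F X ε t + 1 * ∫ s in (0:ℝ)..t, Ebar F X ε s := by
    linarith
  refine Real.iSup_le (fun i => Real.iSup_le (fun s => ?_) hnn) hnn
  obtain ⟨s, hs0, hst⟩ := s
  have hftc : ∫ r in (0:ℝ)..s, fieldAt F X i r = V i s - V i 0 :=
    intervalIntegral.integral_eq_sub_of_hasDerivAt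
      (fun r hr => hV i r (by rw [uIcc_of_le hs0] at hr; exact hr.1)) (hint i 0 s le_rfl hs0)
  have hnorm : ‖V i s - V i 0‖ ≤ ∫ r in (0:ℝ)..s, ‖fieldAt F X i r‖ :=
    hftc ▸ intervalIntegral.norm_integral_le_integral_norm hs0
  have hle : ∫ r in (0:ℝ)..s, ‖fieldAt F X i r‖ ≤ ∫ r in (0:ℝ)..t, ‖fieldAt F X i r‖ :=
    intervalIntegral.integral_mono_interval le_rfl hs0 hst
      (Eventually.of_forall fun _ => norm_nonneg _) (hint i 0 t le_rfl ht).norm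
  have htri := norm_le_norm_add_norm_sub' (V i s) (V i 0)
  have hK := norm_le_Kmax_zero V i
  have hmain := integral_norm_fieldAt_le hint hε i ht
  change ‖V i s‖ ≤ _
  linarith

end
end

section
/- Strong convergence of the time-averaged force along trajectories (convergence (4.6), 'Fconv'): Under the assumptions of Proposition 4.1 (uniform-in-N bounds on R_N(T), K_N(T), Ē_N(T), ΔĒ_N(T), and sup_{t≤T}‖μ_N(t)‖_{∞,η_N} with η_N → 0, and weak convergence of μ_N to f in L^∞([0,T],M¹(ℝ^{2d}))), one has sup_{i, t∈[0,T−ε_N]} (1/ε_N) ∫_t^{t+ε_N} | F_N(s, X_i(s)) − F_∞(s, X_i(s)) | ds → 0 as N → ∞, where F_N(s,x) = (1/N) Σ_{i=1}^N (x − X_i(s))/|x − X_i(s)|^{1+α} and F_∞(s,x) = ∫ (x−y)/|x−y|^{1+α} f(s,y,w) dy dw. -/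
open MeasureTheory Metric Set Filter
open scoped ENNReal

noncomputable section

/-- The singular force `F(x) = x/|x|^{1+α}` (extended by `0` at the origin). -/
def Fsing (d : ℕ) (α : ℝ) (x : Euc d) : Euc d := ‖x‖ ^ (-(1+α)) • x

/-- The force `Fsing`, regularized at distance `δ` from the origin. -/
def Ftrunc (d : ℕ) (α δ : ℝ) (x : Euc d) : Euc d := (max ‖x‖ δ) ^ (-(1+α)) • x

lemma Fsing_neg {d : ℕ} (α : ℝ) (x : Euc d) : Fsing d α (-x) = -Fsing d α x := by
  simp [Fsing]

lemma Ftrunc_neg {d : ℕ} (α δ : ℝ) (x : Euc d) : Ftrunc d α δ (-x) = -Ftrunc d α δ x := by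
  simp [Ftrunc]

lemma Fsing_zero {d : ℕ} (α : ℝ) : Fsing d α 0 = 0 := by simp [Fsing]

lemma Fsing_sub_Ftrunc_of_le {d : ℕ} {α δ : ℝ} {x : Euc d} (h : δ ≤ ‖x‖) :
    Fsing d α x - Ftrunc d α δ x = 0 := by
  simp [Fsing, Ftrunc, max_eq_left h]

lemma norm_Fsing_sub_Ftrunc_le {d : ℕ} {α δ : ℝ} (hα : 0 < α) (x : Euc d) :
    ‖Fsing d α x - Ftrunc d α δ x‖ ≤ ‖x‖ ^ (-α) := by
  rcases eq_or_ne x 0 with rfl | hx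
  · simp only [Fsing, Ftrunc, smul_zero, sub_zero, norm_zero]
    exact Real.rpow_nonneg le_rfl _
  have hx' : 0 < ‖x‖ := norm_pos_iff.2 hx
  have hm : (max ‖x‖ δ) ^ (-(1+α)) ≤ ‖x‖ ^ (-(1+α)) :=
    Real.rpow_le_rpow_of_nonpos hx' (le_max_left _ _) (by linarith)
  have h0 : 0 ≤ (max ‖x‖ δ) ^ (-(1+α)) := Real.rpow_nonneg (by positivity) _
  rw [Fsing, Ftrunc, ← sub_smul, norm_smul, Real.norm_of_nonneg (by linarith)]
  calc _ ≤ ‖x‖ ^ (-(1+α)) * ‖x‖ := by gcongr; linarith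
    _ = ‖x‖ ^ (-α) := by
      rw [show -(1+α) = -α - 1 by ring, Real.rpow_sub_one hx'.ne']
      field_simp

lemma norm_Ftrunc_le {d : ℕ} {α δ : ℝ} (hα : 0 < α) (hδ : 0 < δ) (x : Euc d) :
    ‖Ftrunc d α δ x‖ ≤ δ ^ (-α) := by
  have hm : 0 < max ‖x‖ δ := lt_max_of_lt_right hδ
  rw [Ftrunc, norm_smul, Real.norm_of_nonneg (Real.rpow_nonneg hm.le _)]
  calc _ ≤ (max ‖x‖ δ) ^ (-(1+α)) * max ‖x‖ δ := by gcongr; exact le_max_left _ _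
    _ = (max ‖x‖ δ) ^ (-α) := by
      rw [show -(1+α) = -α - 1 by ring, Real.rpow_sub_one hm.ne']
      field_simp
    _ ≤ δ ^ (-α) := Real.rpow_le_rpow_of_nonpos hδ (le_max_right _ _) (by linarith)

lemma rpow_neg_sub_rpow_neg_mul_le {α p q : ℝ} (hα : 0 < α) (hq : 0 < q) (hqp : q ≤ p) :
    (q ^ (-(1+α)) - p ^ (-(1+α))) * q ≤ (1+α) * q ^ (-(1+α)) * (p - q) := by
  have hp : 0 < p := hq.trans_le hqp
  have hb := one_add_mul_self_le_rpow_one_add (s := q / p - 1)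
    (by have : 0 < q / p := by positivity
        linarith) (p := 1 + α) (by linarith)
  have hpq : p ^ (-(1+α)) = q ^ (-(1+α)) * (q / p) ^ (1+α) := by
    rw [Real.div_rpow hq.le hp.le, Real.rpow_neg hq.le, Real.rpow_neg hp.le]
    have := Real.rpow_pos_of_pos hq (1+α)
    field_simp
  rw [add_sub_cancel] at hb
  have h0 : 0 ≤ q ^ (-(1+α)) := Real.rpow_nonneg hq.le _
  have h1 : (1 - (q / p) ^ (1+α)) * q ≤ (1+α) * (p - q) := by
    have h2 : 1 - (q / p) ^ (1+α) ≤ (1+α) * ((p - q) / p) := by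
      have : (p - q) / p = 1 - q / p := by field_simp
      rw [this]; linarith
    have h3 : (p - q) / p * q ≤ p - q := by
      rw [div_mul_eq_mul_div, div_le_iff₀ hp]
      nlinarith
    nlinarith
  rw [hpq]
  nlinarith

lemma norm_Ftrunc_sub_le {d : ℕ} {α δ : ℝ} (hα : 0 < α) (hδ : 0 < δ) (x y : Euc d) :
    ‖Ftrunc d α δ x - Ftrunc d α δ y‖ ≤ (2+α) * δ ^ (-(1+α)) * ‖x - y‖ := by
  wlog hxy : ‖y‖ ≤ ‖x‖ generalizing x y
  · rw [norm_sub_rev, norm_sub_rev x]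
    exact this y x (le_of_not_ge hxy)
  set p := max ‖x‖ δ with hp
  set q := max ‖y‖ δ with hq
  have hq0 : 0 < q := lt_max_of_lt_right hδ
  have hqp : q ≤ p := max_le_max_right _ hxy
  have hp0 := hq0.trans_le hqp
  have hpq : p - q ≤ ‖x - y‖ := by
    have h1 := norm_sub_norm_le x y
    have h2 : p ≤ q + (‖x‖ - ‖y‖) := by
      apply max_le
      · have := le_max_left ‖y‖ δ; linarith
      · have := le_max_right ‖y‖ δ; linarith
    linarith
  have hqδ : q ^ (-(1+α)) ≤ δ ^ (-(1+α)) :=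
    Real.rpow_le_rpow_of_nonpos hδ (le_max_right _ _) (by linarith)
  have hpδ : p ^ (-(1+α)) ≤ δ ^ (-(1+α)) :=
    Real.rpow_le_rpow_of_nonpos hδ (le_max_right _ _) (by linarith)
  have hpq' : p ^ (-(1+α)) ≤ q ^ (-(1+α)) :=
    Real.rpow_le_rpow_of_nonpos hq0 hqp (by linarith)
  have hdec : Ftrunc d α δ x - Ftrunc d α δ y
      = p ^ (-(1+α)) • (x - y) - (q ^ (-(1+α)) - p ^ (-(1+α))) • y := by
    simp only [Ftrunc, ← hp, ← hq, smul_sub, sub_smul]; abel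
  have hk := rpow_neg_sub_rpow_neg_mul_le hα hq0 hqp
  have hpn : 0 ≤ p ^ (-(1+α)) := Real.rpow_nonneg hp0.le _
  have hqn : 0 ≤ q ^ (-(1+α)) := Real.rpow_nonneg hq0.le _
  calc ‖Ftrunc d α δ x - Ftrunc d α δ y‖
      ≤ p ^ (-(1+α)) * ‖x - y‖ + (q ^ (-(1+α)) - p ^ (-(1+α))) * ‖y‖ := by
        rw [hdec]
        refine (norm_sub_le _ _).trans ?_
        rw [norm_smul, norm_smul, Real.norm_of_nonneg hpn,
          Real.norm_of_nonneg (sub_nonneg.2 hpq')]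
    _ ≤ δ ^ (-(1+α)) * ‖x - y‖ + (q ^ (-(1+α)) - p ^ (-(1+α))) * q := by
        gcongr
        exact le_max_left _ _
    _ ≤ δ ^ (-(1+α)) * ‖x - y‖ + (1+α) * δ ^ (-(1+α)) * ‖x - y‖ := by
        have : (1+α) * q ^ (-(1+α)) * (p - q) ≤ (1+α) * δ ^ (-(1+α)) * ‖x - y‖ := by
          gcongr
        linarith
    _ = _ := by ring

lemma continuous_Ftrunc {d : ℕ} {α δ : ℝ} (hδ : 0 < δ) : Continuous (Ftrunc d α δ) := by
  unfold Ftrunc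
  refine Continuous.smul (Continuous.rpow_const (by fun_prop) fun x => Or.inl ?_) continuous_id
  exact (lt_max_of_lt_right hδ).ne'

lemma measurable_Fsing {d : ℕ} {α : ℝ} : Measurable (Fsing d α) := by
  unfold Fsing
  fun_prop

/-- The constant of the dyadic summation of `|x|^{-α}` against a linearly growing mass. -/
def dyadicConst (α : ℝ) : ℝ := 2 ^ α * (1 - 2⁻¹ ^ (1 - α))⁻¹

lemma dyadicConst_pos {α : ℝ} (hα1 : α < 1) : 0 < dyadicConst α := by
  have : (2⁻¹ : ℝ) ^ (1 - α) < 1 := Real.rpow_lt_one (by norm_num) (by norm_num) (by linarith)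
  have h1 : 0 < 1 - (2⁻¹ : ℝ) ^ (1 - α) := by linarith
  unfold dyadicConst
  positivity

lemma setLIntegral_rpow_neg_le {Ω : Type*} [MeasurableSpace Ω] {ν : Measure Ω} {ξ : Ω → ℝ}
    (hξ : Measurable ξ) (hξ0 : ∀ ω, 0 ≤ ξ ω) {α δ : ℝ} (hα : 0 < α) (hα1 : α < 1) (hδ : 0 < δ)
    {M : ℝ≥0∞} (hM : ∀ σ, 0 < σ → σ ≤ δ → ν {ω | ξ ω ≤ σ} ≤ M * ENNReal.ofReal σ) :
    ∫⁻ ω in {ω | ξ ω ≤ δ}, ENNReal.ofReal (ξ ω ^ (-α)) ∂ν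
      ≤ M * ENNReal.ofReal (dyadicConst α * δ ^ (1 - α)) := by
  have hms : ∀ σ : ℝ, MeasurableSet {ω | ξ ω ≤ σ} := fun σ => measurableSet_le hξ measurable_const
  have hq0 : (0:ℝ) < 2⁻¹ ^ (1 - α) := by positivity
  have hq1 : (2⁻¹ : ℝ) ^ (1 - α) < 1 :=
    Real.rpow_lt_one (by norm_num) (by norm_num) (by linarith)
  let c : ℕ → ℝ := fun l => (δ * 2⁻¹ ^ (l + 1)) ^ (-α)
  have hpt : ∀ ω, {ω | ξ ω ≤ δ}.indicator (fun ω => ENNReal.ofReal (ξ ω ^ (-α))) ω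
      ≤ ∑' l : ℕ, {ω | ξ ω ≤ δ * 2⁻¹ ^ l}.indicator (fun _ => ENNReal.ofReal (c l)) ω := by
    intro ω
    by_cases hω : ξ ω ≤ δ
    swap
    · simp [indicator, hω]
    rcases (hξ0 ω).eq_or_lt with h0 | h0
    · simp [indicator, ← h0, Real.zero_rpow (neg_ne_zero.2 hα.ne')]
    obtain ⟨n, hn1, hn2⟩ := exists_nat_pow_near_of_lt_one (x := ξ ω / δ) (y := (2⁻¹ : ℝ))
      (by positivity) (by rwa [div_le_one hδ]) (by norm_num) (by norm_num)
    rw [lt_div_iff₀' hδ] at hn1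
    rw [div_le_iff₀' hδ] at hn2
    refine le_trans ?_ (ENNReal.le_tsum n)
    rw [indicator_of_mem (show ω ∈ {ω | ξ ω ≤ δ} from hω),
      indicator_of_mem (show ω ∈ {ω | ξ ω ≤ δ * 2⁻¹ ^ n} from hn2)]
    exact ENNReal.ofReal_le_ofReal
      (Real.rpow_le_rpow_of_nonpos (by positivity) hn1.le (by linarith))
  have hterm : ∀ l : ℕ, c l * (δ * 2⁻¹ ^ l) = 2 ^ α * δ ^ (1 - α) * (2⁻¹ ^ (1 - α)) ^ l := by
    intro l
    have h2 : (0:ℝ) < 2⁻¹ ^ l := by positivity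
    have e1 : c l = (δ * 2⁻¹ ^ l) ^ (-α) * 2 ^ α := by
      simp only [c]
      rw [pow_succ, ← mul_assoc, Real.mul_rpow (by positivity) (by norm_num),
        Real.inv_rpow (by norm_num), Real.rpow_neg (by norm_num : (0:ℝ) ≤ 2), inv_inv]
    have e2 : (δ * 2⁻¹ ^ l) ^ (-α) * (δ * 2⁻¹ ^ l) = δ ^ (1 - α) * (2⁻¹ ^ (1 - α)) ^ l := by
      rw [← Real.rpow_add_one (by positivity), show -α + 1 = 1 - α by ring,
        Real.mul_rpow hδ.le h2.le, Real.rpow_pow_comm (by norm_num)]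
    rw [e1, mul_right_comm, e2]; ring
  have hgeo := (hasSum_geometric_of_lt_one hq0.le hq1).mul_left (2 ^ α * δ ^ (1 - α))
  rw [← lintegral_indicator (hms δ)]
  calc _ ≤ ∫⁻ ω, ∑' l : ℕ, {ω | ξ ω ≤ δ * 2⁻¹ ^ l}.indicator
        (fun _ => ENNReal.ofReal (c l)) ω ∂ν := lintegral_mono hpt
    _ = ∑' l : ℕ, ENNReal.ofReal (c l) * ν {ω | ξ ω ≤ δ * 2⁻¹ ^ l} := by
        rw [lintegral_tsum fun l => (measurable_const.indicator (hms _)).aemeasurable]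
        exact tsum_congr fun l => lintegral_indicator_const (hms _) _
    _ ≤ ∑' l : ℕ, M * ENNReal.ofReal (c l * (δ * 2⁻¹ ^ l)) := by
        refine ENNReal.tsum_le_tsum fun l => ?_
        have hl : (2⁻¹ : ℝ) ^ l ≤ 1 := pow_le_one₀ (by norm_num) (by norm_num)
        have := hM (δ * 2⁻¹ ^ l) (by positivity) (by nlinarith)
        rw [ENNReal.ofReal_mul (by positivity), mul_left_comm]
        gcongr
    _ = M * ENNReal.ofReal (dyadicConst α * δ ^ (1 - α)) := by
        rw [ENNReal.tsum_mul_left, ← ENNReal.ofReal_tsum_of_nonneg]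
        · simp only [hterm]
          rw [hgeo.tsum_eq, dyadicConst]; congr 2; ring
        · intro l; positivity
        · simp only [hterm]; exact hgeo.summable

lemma sum_rpow_neg_le {ι : Type*} [Fintype ι] {ξ : ι → ℝ} (hξ0 : ∀ k, 0 ≤ ξ k) {α δ M : ℝ}
    (hα : 0 < α) (hα1 : α < 1) (hδ : 0 < δ) (hM0 : 0 ≤ M)
    (hM : ∀ σ, 0 < σ → σ ≤ δ → ((Finset.univ.filter fun k => ξ k ≤ σ).card : ℝ) ≤ M * σ) :
    ∑ k, (if ξ k ≤ δ then ξ k ^ (-α) else 0) ≤ M * (dyadicConst α * δ ^ (1 - α)) := by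
  let _ : MeasurableSpace ι := ⊤
  have h := setLIntegral_rpow_neg_le (ν := Measure.count) (ξ := ξ) measurable_from_top hξ0 hα hα1
    hδ (M := ENNReal.ofReal M) (fun σ h0 hσ => by
      have h1 : {ω | ξ ω ≤ σ} = ((Finset.univ.filter fun k => ξ k ≤ σ : Finset ι) : Set ι) := by
        ext; simp
      rw [h1, Measure.count_apply_finset, ← ENNReal.ofReal_mul hM0, ← ENNReal.ofReal_natCast]
      exact ENNReal.ofReal_le_ofReal (hM σ h0 hσ))
  rw [← lintegral_indicator (MeasurableSpace.measurableSet_top), lintegral_count,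
    tsum_fintype, ← ENNReal.ofReal_mul hM0] at h
  have hd := dyadicConst_pos hα1
  rw [← ENNReal.ofReal_le_ofReal_iff (by positivity)]
  refine le_trans (le_of_eq ?_) h
  rw [ENNReal.ofReal_sum_of_nonneg]
  · refine Finset.sum_congr rfl fun k _ => ?_
    by_cases hk : ξ k ≤ δ <;> simp [indicator, hk]
  · intro k _
    split_ifs
    · exact Real.rpow_nonneg (hξ0 k) _
    · rfl

lemma integral_empMeas {d N : ℕ} (X V : Fin N → ℝ → Euc d) (t : ℝ) (g : Phase d → ℝ) :
    ∫ z, g z ∂(empMeas X V t) = (N : ℝ)⁻¹ * ∑ i, g (X i t, V i t) := by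
  rw [empMeas, integral_smul_measure, integral_finsetSum_measure]
  · simp [integral_dirac]
  · intro i _
    exact integrable_dirac (by simp)

lemma empMeas_toReal {d N : ℕ} (X V : Fin N → ℝ → Euc d) (t : ℝ) (A : Set (Phase d)) :
    (empMeas X V t A).toReal
      = (N : ℝ)⁻¹ * ∑ i, A.indicator (fun _ => (1:ℝ)) (X i t, V i t) := by
  rw [empMeas, Measure.smul_apply, Measure.finsetSum_apply, smul_eq_mul, ENNReal.toReal_mul,
    ENNReal.toReal_sum (fun i _ => by simp [Measure.dirac_apply, indicator]; split_ifs <;> simp)]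
  simp only [ENNReal.toReal_inv, ENNReal.toReal_natCast, Measure.dirac_apply]
  congr 1
  refine Finset.sum_congr rfl fun i _ => ?_
  by_cases h : (X i t, V i t) ∈ A <;> simp [h]

lemma empMeas_toReal_le_one {d N : ℕ} (X V : Fin N → ℝ → Euc d) (t : ℝ) (A : Set (Phase d)) :
    (empMeas X V t A).toReal ≤ 1 := by
  rw [empMeas_toReal]
  have h : ∑ i, A.indicator (fun _ => (1:ℝ)) (X i t, V i t) ≤ ∑ _i : Fin N, (1:ℝ) :=
    Finset.sum_le_sum fun i _ => indicator_le_self' (fun _ _ => zero_le_one) _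
  simp only [Finset.sum_const, Finset.card_univ, Fintype.card_fin, nsmul_eq_mul, mul_one] at h
  rcases Nat.eq_zero_or_pos N with rfl | hN
  · simp
  · have : (0:ℝ) < N := by exact_mod_cast hN
    rw [inv_mul_le_iff₀ this]; linarith

lemma empMeas_Binf_le {d N : ℕ} {X V : Fin N → ℝ → Euc d} {t η CB : ℝ} (hη : 0 < η)
    (h : discNorm (empMeas X V t) η ≤ CB) (z : Phase d) :
    (empMeas X V t (Binf z η)).toReal ≤ CB * (2 * η) ^ (2 * d) := by
  have hb : BddAbove (range fun z : Phase d => (empMeas X V t (Binf z η)).toReal) :=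
    ⟨1, by rintro _ ⟨z, rfl⟩; exact empMeas_toReal_le_one X V t _⟩
  have h1 := le_ciSup hb z
  rw [discNorm, inv_mul_le_iff₀ (by positivity)] at h
  exact h1.trans (h.trans_eq (mul_comm _ _))

lemma floor_box {a s η : ℝ} (hη : 0 < η) (ha : |a| ≤ s) :
    ⌊(a + s) / (2 * η)⌋₊ < ⌊s / η⌋₊ + 1 ∧
      |a - (2 * η * ⌊(a + s) / (2 * η)⌋₊ - s + η)| ≤ η := by
  obtain ⟨h1, h2⟩ := abs_le.1 ha
  have h0 : 0 ≤ (a + s) / (2 * η) := div_nonneg (by linarith) (by linarith)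
  constructor
  · rw [Nat.lt_succ_iff]
    apply Nat.floor_le_floor
    rw [div_le_div_iff₀ (by positivity) hη]
    nlinarith
  · have h3 := Nat.floor_le h0
    have h4 := Nat.lt_floor_add_one ((a + s) / (2 * η))
    rw [le_div_iff₀ (by positivity)] at h3
    rw [div_lt_iff₀ (by positivity)] at h4
    rw [abs_le]
    constructor <;> nlinarith

/-- The constant bounding the spatial density in terms of the phase-space density. -/
def countConst (d : ℕ) (CB : ℝ) : ℝ := CB * (8 * (CB + 1)) ^ d

lemma card_ball_le {d N : ℕ} (hd : 2 ≤ d) (hN : 0 < N) {X V : Fin N → ℝ → Euc d}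
    {t η CB : ℝ} (hη : 0 < η) (hη1 : η ≤ 1) (hCB : 0 ≤ CB) (hV : ∀ i, ‖V i t‖ ≤ CB)
    (hdisc : discNorm (empMeas X V t) η ≤ CB) (x : Euc d) {s : ℝ} (hs : η ≤ s) (hs1 : s ≤ 1) :
    ((Finset.univ.filter fun j => ‖X j t - x‖ ≤ s).card : ℝ) ≤ N * (countConst d CB * s ^ 2) := by
  classical
  have hN' : (0:ℝ) < N := by exact_mod_cast hN
  have hs0 : 0 < s := hη.trans_le hs
  set n : ℕ := ⌊N * (CB * (2 * η) ^ (2 * d))⌋₊ with hn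
  let φ : Fin N → (Fin d → ℕ) × (Fin d → ℕ) := fun j =>
    (fun k => ⌊((X j t - x) k + s) / (2 * η)⌋₊, fun k => ⌊(V j t k + CB) / (2 * η)⌋₊)
  let P := (Fintype.piFinset fun _ : Fin d => Finset.range (⌊s / η⌋₊ + 1)) ×ˢ
    (Fintype.piFinset fun _ : Fin d => Finset.range (⌊CB / η⌋₊ + 1))
  have hx : ∀ j ∈ Finset.univ.filter (fun j => ‖X j t - x‖ ≤ s), ∀ k, |(X j t - x) k| ≤ s := by
    intro j hj k
    rw [← Real.norm_eq_abs]
    exact (PiLp.norm_apply_le _ k).trans (Finset.mem_filter.1 hj).2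
  have hv : ∀ j k, |V j t k| ≤ CB := fun j k => by
    rw [← Real.norm_eq_abs]
    exact (PiLp.norm_apply_le _ k).trans (hV j)
  have hcard := Finset.card_le_mul_card_image_of_maps_to (f := φ)
    (s := Finset.univ.filter fun j => ‖X j t - x‖ ≤ s) (t := P) (fun j hj => by
      simp only [P, φ, Finset.mem_product, Fintype.mem_piFinset, Finset.mem_range]
      exact ⟨fun k => (floor_box hη (hx j hj k)).1, fun k => (floor_box hη (hv j k)).1⟩) n
    (fun b _ => by
      let z : Phase d := (x + WithLp.toLp 2 fun k => 2 * η * b.1 k - s + η,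
        WithLp.toLp 2 fun k => 2 * η * b.2 k - CB + η)
      have hz := empMeas_Binf_le hη hdisc z
      rw [empMeas_toReal, inv_mul_le_iff₀ hN'] at hz
      rw [hn]
      apply Nat.le_floor
      refine le_trans ?_ hz
      rw [Finset.card_eq_sum_ones, Nat.cast_sum, Finset.sum_filter]
      rw [Finset.sum_filter]
      refine Finset.sum_le_sum fun j _ => ?_
      by_cases hj : ‖X j t - x‖ ≤ s
      swap
      · simp only [hj, if_false]
        exact indicator_nonneg (fun _ _ => zero_le_one) _
      by_cases hb : φ j = b
      swap
      · simp only [hb, if_false, ite_self]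
        exact indicator_nonneg (fun _ _ => zero_le_one) _
      rw [indicator_of_mem]
      · simp [hj, hb]
      · constructor
        · intro k
          have := (floor_box hη (hx j (by simpa using hj) k)).2
          have hbk : b.1 k = ⌊((X j t - x) k + s) / (2 * η)⌋₊ := by rw [← hb]
          rw [← hbk, PiLp.sub_apply, sub_sub] at this
          exact this
        · intro k
          have := (floor_box hη (hv j k)).2
          have hbk : b.2 k = ⌊(V j t k + CB) / (2 * η)⌋₊ := by rw [← hb]
          rw [← hbk] at this
          exact this)
  have hP : (P.card : ℝ) ≤ (2 * s / η) ^ d * ((CB + 1) / η) ^ d := by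
    simp only [P, Finset.card_product, Fintype.card_piFinset, Finset.card_range,
      Finset.prod_const, Finset.card_univ, Fintype.card_fin]
    push_cast
    have h1 : (⌊s / η⌋₊ : ℝ) + 1 ≤ 2 * s / η := by
      have := Nat.floor_le (div_nonneg hs0.le hη.le)
      have h2 : 1 ≤ s / η := by rwa [one_le_div hη]
      rw [mul_div_assoc]; linarith
    have h3 : (⌊CB / η⌋₊ : ℝ) + 1 ≤ (CB + 1) / η := by
      have := Nat.floor_le (div_nonneg hCB hη.le)
      have h2 : 1 ≤ 1 / η := by rwa [one_le_div hη]
      rw [add_div]; linarith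
    gcongr
  have hnr : (n : ℝ) ≤ N * (CB * (2 * η) ^ (2 * d)) := Nat.floor_le (by positivity)
  have hsd : s ^ d ≤ s ^ 2 := pow_le_pow_of_le_one hs0.le hs1 hd
  calc ((Finset.univ.filter fun j => ‖X j t - x‖ ≤ s).card : ℝ) ≤ n * P.card := by
        exact_mod_cast hcard
    _ ≤ (N * (CB * (2 * η) ^ (2 * d))) * ((2 * s / η) ^ d * ((CB + 1) / η) ^ d) := by gcongr
    _ = N * (CB * (8 * (CB + 1)) ^ d * s ^ d) := by
        have : (2 * η) ^ (2 * d) * ((2 * s / η) ^ d * ((CB + 1) / η) ^ d)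
            = (8 * (CB + 1)) ^ d * s ^ d := by
          rw [pow_mul, ← mul_pow, ← mul_pow, ← mul_pow]
          congr 1
          field_simp
          ring
        linear_combination (N * CB : ℝ) * this
    _ ≤ _ := by
        rw [countConst]
        gcongr

/-- A scale at which the mass is doubling while being at most linear at all larger scales. -/
lemma exists_doubling_scale {n : ℝ → ℝ} {M r₀ r₁ ρ : ℝ} {q : ℕ} (hq : 1 ≤ q) (hr₀ : 0 < r₀)
    (h01 : r₀ ≤ r₁) (h1 : 4 * r₁ ≤ ρ) (hM : 0 < M) (hn0 : 1 ≤ n r₀) (hMr₀ : M ^ 2 * r₀ ^ q ≤ 1)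
    (hlt : ∀ r, r₁ < r → r ≤ ρ → n r < M * r) (hub : ∀ r, n r ≤ M) (hMr₁ : 1 < M * r₁ ^ q) :
    ∃ r, r₀ ≤ r ∧ r ≤ r₁ ∧ n (4 * r) ≤ 4 ^ q * n r ∧ ∀ σ, 2 * r ≤ σ → σ ≤ ρ → n σ ≤ M * σ := by
  let φ : ℝ → ℝ := fun r => min (M * r) (M ^ 2 * r ^ q)
  let S := {r | r₀ ≤ r ∧ r ≤ ρ ∧ φ r ≤ n r}
  have hr₀S : r₀ ∈ S := ⟨le_rfl, by linarith, (min_le_right _ _).trans (hMr₀.trans hn0)⟩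
  have hS1 : ∀ r ∈ S, r ≤ r₁ := by
    rintro r ⟨-, hrρ, hrn⟩
    by_contra! hr
    have h2 : n r < M ^ 2 * r ^ q := by
      have : r₁ ^ q ≤ r ^ q := pow_le_pow_left₀ (by linarith) hr.le q
      calc n r ≤ M := hub r
        _ < M * (M * r₁ ^ q) := lt_mul_of_one_lt_right hM hMr₁
        _ ≤ M * (M * r ^ q) := by gcongr
        _ = _ := by ring
    exact absurd hrn (not_le.2 (lt_min (hlt r hr hrρ) h2))
  have hbd : BddAbove S := ⟨r₁, hS1⟩
  have hs0 : r₀ ≤ sSup S := le_csSup hbd hr₀S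
  obtain ⟨r, hrS, hr⟩ := exists_lt_of_lt_csSup ⟨r₀, hr₀S⟩
    (show sSup S / 2 < sSup S by linarith)
  have hbig : ∀ σ, 2 * r ≤ σ → σ ≤ ρ → n σ < φ σ := by
    intro σ hσ hσρ
    by_contra! h
    have := le_csSup hbd (show σ ∈ S from ⟨by linarith [hrS.1], hσρ, h⟩)
    linarith
  have hr0 : 0 < r := hr₀.trans_le hrS.1
  refine ⟨r, hrS.1, hS1 r hrS, ?_, fun σ h2 h3 => (hbig σ h2 h3).le.trans (min_le_left _ _)⟩
  have h4 : (4:ℝ) ≤ 4 ^ q := le_self_pow₀ (by norm_num) (by omega)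
  calc n (4 * r) ≤ φ (4 * r) := (hbig _ (by linarith) (by linarith [hS1 r hrS])).le
    _ ≤ 4 ^ q * φ r := by
        simp only [φ]
        rw [mul_min_of_nonneg _ _ (by positivity)]
        apply min_le_min
        · have : 0 < M * r := by positivity
          nlinarith
        · rw [mul_pow]; apply le_of_eq; ring
    _ ≤ _ := by gcongr; exact hrS.2.2

/-- The contribution of the close particles to the force felt by particle `i`. -/
def nearField {d N : ℕ} (α δ : ℝ) (Y : Fin N → Euc d) (i : Fin N) : Euc d :=
  (N : ℝ)⁻¹ • ∑ k, (Fsing d α (Y i - Y k) - Ftrunc d α δ (Y i - Y k))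

lemma norm_sum_weight_odd_le {d N : ℕ} (G : Euc d → Euc d) (hG : ∀ x, G (-x) = -G x)
    (Y : Fin N → Euc d) (w : Fin N → ℝ) (B : Finset (Fin N)) (hB : ∀ j, j ∉ B → w j = 0) :
    ‖∑ j, w j • ∑ k, G (Y j - Y k)‖ ≤ ∑ j ∈ B, ∑ k, |w j - w k| * ‖G (Y j - Y k)‖ := by
  set S := ∑ j, w j • ∑ k, G (Y j - Y k) with hS
  have hG' : ∀ j k, ‖G (Y j - Y k)‖ = ‖G (Y k - Y j)‖ := fun j k => by
    rw [← norm_neg, ← hG, neg_sub]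
  have h1 : S = ∑ j, ∑ k, w j • G (Y j - Y k) := by simp only [hS, Finset.smul_sum]
  have h2 : S = -∑ j, ∑ k, w k • G (Y j - Y k) := by
    rw [h1, Finset.sum_comm, ← Finset.sum_neg_distrib]
    refine Finset.sum_congr rfl fun j _ => ?_
    rw [← Finset.sum_neg_distrib]
    refine Finset.sum_congr rfl fun k _ => ?_
    rw [← smul_neg, ← hG, neg_sub]
  have h3 : S + S = ∑ j, ∑ k, (w j - w k) • G (Y j - Y k) := by
    nth_rewrite 1 [h1]
    nth_rewrite 1 [h2]
    rw [← sub_eq_add_neg, ← Finset.sum_sub_distrib]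
    refine Finset.sum_congr rfl fun j _ => ?_
    rw [← Finset.sum_sub_distrib]
    simp only [sub_smul]
  let a : Fin N → Fin N → ℝ := fun j k => |w j - w k| * ‖G (Y j - Y k)‖
  have ha : ∀ j k, a j k = a k j := fun j k => by simp only [a]; rw [abs_sub_comm, hG']
  have ha0 : ∀ j k, 0 ≤ a j k := fun j k => by positivity
  have h4 : ‖S + S‖ ≤ ∑ j, ∑ k, a j k := by
    rw [h3]
    refine norm_sum_le_of_le _ fun j _ => norm_sum_le_of_le _ fun k _ => ?_
    rw [norm_smul, Real.norm_eq_abs]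
  have h5 : ∑ j, ∑ k, a j k ≤ ∑ j, ∑ k, ((if j ∈ B then a j k else 0) +
      (if k ∈ B then a j k else 0)) := by
    refine Finset.sum_le_sum fun j _ => Finset.sum_le_sum fun k _ => ?_
    by_cases hj : j ∈ B <;> by_cases hk : k ∈ B <;> simp [hj, hk, ha0]
    simp [a, hB j hj, hB k hk]
  have h6 : ∑ j, ∑ k, (if j ∈ B then a j k else 0) = ∑ j ∈ B, ∑ k, a j k := by
    rw [← Finset.sum_filter_add_sum_filter_not Finset.univ (· ∈ B)]
    simp only [Finset.filter_univ_mem]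
    rw [Finset.sum_congr rfl (g := fun j => ∑ k, a j k) fun j hj => by simp [hj], add_eq_left]
    exact Finset.sum_eq_zero fun j hj => by simp [(Finset.mem_filter.1 hj).2]
  have h7 : ∑ j, ∑ k, (if k ∈ B then a j k else 0) = ∑ j ∈ B, ∑ k, a j k := by
    rw [Finset.sum_comm, ← h6]
    simp only [ha]
  simp only [Finset.sum_add_distrib] at h5
  rw [h6, h7] at h5
  rw [← two_smul ℝ, norm_smul, Real.norm_ofNat] at h4
  change _ ≤ ∑ j ∈ B, ∑ k, a j k
  linarith

lemma card_mul_norm_nearField_le {d N : ℕ} (hN : 0 < N) {α δ r : ℝ} (hα : 0 < α) (hα1 : α < 1)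
    (hr : 0 < r) (hrδ : r ≤ δ) (Y : Fin N → Euc d) (i : Fin N) (A B : Finset (Fin N))
    (hA : ∀ j ∈ A, ‖Y j - Y i‖ ≤ 2 * r) (hB : ∀ j, ‖Y j - Y i‖ < 3 * r → j ∈ B)
    (hcount : ∀ j ∈ B, ∀ σ, r ≤ σ → σ ≤ δ →
      ((Finset.univ.filter fun k => ‖Y j - Y k‖ ≤ σ).card : ℝ) ≤ N * (6 * σ)) :
    A.card * ‖nearField α δ Y i‖ ≤ B.card * (6 * (dyadicConst α * δ ^ (1 - α))) +
      ∑ j ∈ B, ‖nearField α δ Y i - nearField α δ Y j‖ := by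
  have hN' : (0:ℝ) < N := by exact_mod_cast hN
  have hδ : 0 < δ := hr.trans_le hrδ
  set G : Euc d → Euc d := fun x => Fsing d α x - Ftrunc d α δ x with hGdef
  have hG : ∀ x, G (-x) = -G x := fun x => by
    simp only [G, Fsing_neg, Ftrunc_neg]; abel
  let w : Fin N → ℝ := fun j => max 0 (min 1 (3 - ‖Y j - Y i‖ / r))
  have hw0 : ∀ j, 0 ≤ w j := fun j => le_max_left _ _
  have hw1 : ∀ j, w j ≤ 1 := fun j => max_le zero_le_one (min_le_left _ _)
  have hwB : ∀ j, j ∉ B → w j = 0 := by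
    intro j hj
    have h : 3 * r ≤ ‖Y j - Y i‖ := not_lt.1 fun h => hj (hB j h)
    rw [← le_div_iff₀ hr] at h
    exact max_eq_left ((min_le_right _ _).trans (by linarith))
  have hwA : ∀ j ∈ A, w j = 1 := by
    intro j hj
    have h := hA j hj
    rw [← div_le_iff₀ hr] at h
    simp only [w]
    rw [min_eq_left (by linarith), max_eq_right zero_le_one]
  have hAB : A ⊆ B := fun j hj => by
    by_contra h
    have := hwA j hj
    rw [hwB j h] at this
    norm_num at this
  have hwlip : ∀ j k, |w j - w k| ≤ ‖Y j - Y k‖ / r := by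
    intro j k
    simp only [w]
    rw [max_comm 0, max_comm 0]
    refine (abs_max_sub_max_le_abs _ _ 0).trans ?_
    rw [min_comm 1, min_comm 1]
    refine (abs_min_sub_min_le_max _ 1 _ 1).trans ?_
    simp only [sub_self, abs_zero]
    refine max_le ?_ (by positivity)
    rw [show 3 - ‖Y j - Y i‖ / r - (3 - ‖Y k - Y i‖ / r)
      = (‖Y k - Y i‖ - ‖Y j - Y i‖) / r by ring, abs_div, abs_of_pos hr]
    gcongr
    refine (abs_norm_sub_norm_le _ _).trans (le_of_eq ?_)
    rw [sub_sub_sub_cancel_right, norm_sub_rev]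
  have hpair : ∀ j k, |w j - w k| * ‖G (Y j - Y k)‖ ≤
      if max ‖Y j - Y k‖ r ≤ δ then (max ‖Y j - Y k‖ r) ^ (-α) else 0 := by
    intro j k
    set D := ‖Y j - Y k‖ with hD
    have hD0 : 0 ≤ D := norm_nonneg _
    split_ifs with hle
    · have h1 := norm_Fsing_sub_Ftrunc_le (δ := δ) hα (Y j - Y k)
      have hG1 : ‖G (Y j - Y k)‖ ≤ D ^ (-α) := h1
      rcases le_total r D with h | h
      · rw [max_eq_left h]
        have : |w j - w k| ≤ 1 := by
          rw [abs_le]; constructor <;> linarith [hw0 j, hw0 k, hw1 j, hw1 k]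
        calc _ ≤ 1 * D ^ (-α) := by gcongr
          _ = _ := one_mul _
      · rw [max_eq_right h]
        rcases hD0.eq_or_lt with h0 | h0
        · have h2 := hwlip j k
          rw [← hD, ← h0, zero_div] at h2
          have h3 : |w j - w k| = 0 := le_antisymm h2 (abs_nonneg _)
          rw [h3, zero_mul]
          positivity
        · calc _ ≤ D / r * D ^ (-α) := by gcongr; exact hwlip j k
            _ = D ^ (1 - α) / r := by
              rw [sub_eq_add_neg, add_comm, Real.rpow_add_one h0.ne']; ring
            _ ≤ r ^ (1 - α) / r := by gcongr
            _ = r ^ (-α) := by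
              rw [sub_eq_add_neg, add_comm, Real.rpow_add_one hr.ne']; field_simp
    · have : δ ≤ D := by
        by_contra! h
        exact hle (max_le h.le hrδ)
      have h0 : G (Y j - Y k) = 0 := Fsing_sub_Ftrunc_of_le this
      simp [h0]
  have hcross : ‖∑ j, w j • ∑ k, G (Y j - Y k)‖ ≤
      B.card * (6 * N * (dyadicConst α * δ ^ (1 - α))) := by
    refine (norm_sum_weight_odd_le G hG Y w B hwB).trans ?_
    rw [← nsmul_eq_mul]
    refine Finset.sum_le_card_nsmul _ _ _ fun j hj => ?_
    refine (Finset.sum_le_sum fun k _ => hpair j k).trans ?_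
    refine sum_rpow_neg_le (fun k => by positivity) hα hα1 hδ (by positivity) fun σ h0 hσ => ?_
    by_cases hrσ : r ≤ σ
    · calc _ ≤ ((Finset.univ.filter fun k => ‖Y j - Y k‖ ≤ σ).card : ℝ) := by
            gcongr with k
            exact le_max_left _ _
        _ ≤ N * (6 * σ) := hcount j hj σ hrσ hσ
        _ = _ := by ring
    · rw [Finset.filter_false_of_mem]
      · simp only [Finset.card_empty, Nat.cast_zero]; positivity
      · intro k _ h
        exact hrσ ((le_max_right _ _).trans h)
  have hnf : ∀ j, nearField α δ Y j = (N:ℝ)⁻¹ • ∑ k, G (Y j - Y k) := fun j => rfl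
  have hid : (∑ j ∈ B, w j) • nearField α δ Y i
      = ∑ j ∈ B, w j • (nearField α δ Y i - nearField α δ Y j)
        + (N:ℝ)⁻¹ • ∑ j, w j • ∑ k, G (Y j - Y k) := by
    have h1 : ∑ j, w j • ∑ k, G (Y j - Y k) = ∑ j ∈ B, w j • ∑ k, G (Y j - Y k) := by
      symm
      apply Finset.sum_subset (Finset.subset_univ B)
      intro j _ hj
      rw [hwB j hj, zero_smul]
    rw [h1, Finset.smul_sum, ← Finset.sum_add_distrib, Finset.sum_smul]
    refine Finset.sum_congr rfl fun j _ => ?_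
    rw [smul_comm, ← hnf, smul_sub]; abel
  have hW : (A.card : ℝ) ≤ ∑ j ∈ B, w j := by
    calc (A.card : ℝ) = ∑ j ∈ A, w j := by
          rw [Finset.sum_congr rfl hwA]; simp
      _ ≤ _ := Finset.sum_le_sum_of_subset_of_nonneg hAB fun j _ _ => hw0 j
  calc A.card * ‖nearField α δ Y i‖ ≤ (∑ j ∈ B, w j) * ‖nearField α δ Y i‖ := by gcongr
    _ = ‖(∑ j ∈ B, w j) • nearField α δ Y i‖ := by
        rw [norm_smul, Real.norm_of_nonneg (Finset.sum_nonneg fun j _ => hw0 j)]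
    _ ≤ ∑ j ∈ B, ‖nearField α δ Y i - nearField α δ Y j‖ +
        (N:ℝ)⁻¹ * (B.card * (6 * N * (dyadicConst α * δ ^ (1 - α)))) := by
        rw [hid]
        refine (norm_add_le _ _).trans (add_le_add (norm_sum_le_of_le _ fun j _ => ?_) ?_)
        · rw [norm_smul, Real.norm_of_nonneg (hw0 j)]
          exact mul_le_of_le_one_left (norm_nonneg _) (hw1 j)
        · rw [norm_smul, Real.norm_of_nonneg (by positivity)]
          gcongr
    _ = _ := by field_simp; ring

lemma fieldAt_eq_sum {d N : ℕ} (α : ℝ) (X : Fin N → ℝ → Euc d) (i : Fin N) (s : ℝ) :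
    fieldAt (Fsing d α) X i s = (N : ℝ)⁻¹ • ∑ k, Fsing d α (X i s - X k s) := by
  rw [fieldAt, ← Finset.add_sum_erase _ _ (Finset.mem_univ i), sub_self, Fsing_zero, zero_add]

/-- The regularized force field at `x` generated by the configuration `Y`. -/
def truncField {d N : ℕ} (α δ : ℝ) (Y : Fin N → Euc d) (x : Euc d) : Euc d :=
  (N : ℝ)⁻¹ • ∑ k, Ftrunc d α δ (x - Y k)

lemma nearField_eq {d N : ℕ} (α δ : ℝ) (X : Fin N → ℝ → Euc d) (i : Fin N) (s : ℝ) :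
    nearField α δ (fun k => X k s) i
      = fieldAt (Fsing d α) X i s - truncField α δ (fun k => X k s) (X i s) := by
  rw [nearField, Finset.sum_sub_distrib, smul_sub, fieldAt_eq_sum, truncField]

lemma norm_inv_smul_sum_le {d N : ℕ} {C : ℝ} (hC : 0 ≤ C) {g : Fin N → Euc d}
    (hg : ∀ k, ‖g k‖ ≤ C) : ‖(N : ℝ)⁻¹ • ∑ k, g k‖ ≤ C := by
  rcases Nat.eq_zero_or_pos N with rfl | hN
  · simpa using hC
  have hN' : (0:ℝ) < N := by exact_mod_cast hN
  rw [norm_smul, Real.norm_of_nonneg (by positivity), inv_mul_le_iff₀ hN']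
  refine (norm_sum_le_of_le _ fun k _ => hg k).trans ?_
  simp

lemma norm_truncField_sub_le {d N : ℕ} {α δ : ℝ} (hα : 0 < α) (hδ : 0 < δ) (Y Z : Fin N → Euc d)
    {D : ℝ} (hD : 0 ≤ D) (x y : Euc d) (hYZ : ∀ k, ‖(x - Y k) - (y - Z k)‖ ≤ D) :
    ‖truncField α δ Y x - truncField α δ Z y‖ ≤ (2+α) * δ ^ (-(1+α)) * D := by
  rw [truncField, truncField, ← smul_sub, ← Finset.sum_sub_distrib]
  refine norm_inv_smul_sum_le (by positivity) fun k => ?_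
  refine (norm_Ftrunc_sub_le hα hδ _ _).trans ?_
  gcongr
  exact hYZ k

lemma continuousOn_fieldAt {d N : ℕ} {α : ℝ} {X : Fin N → ℝ → Euc d} {S : Set ℝ}
    (hX : ∀ i, ContinuousOn (X i) S) (hsep : ∀ i j, i ≠ j → ∀ t ∈ S, X i t ≠ X j t) (i : Fin N) :
    ContinuousOn (fieldAt (Fsing d α) X i) S := by
  have h : ContinuousOn (fun t => ∑ j ∈ Finset.univ.erase i, Fsing d α (X i t - X j t)) S := by
    refine continuousOn_finsetSum _ fun j hj => ?_
    have hij := (hX i).sub (hX j)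
    refine ContinuousOn.smul (hij.norm.rpow_const fun t ht => Or.inl ?_) hij
    exact norm_ne_zero_iff.2 (sub_ne_zero.2 (hsep i j (Finset.ne_of_mem_erase hj).symm t ht))
  exact h.const_smul (N : ℝ)⁻¹

lemma continuousOn_truncField {d N : ℕ} {α δ : ℝ} (hδ : 0 < δ) {X : Fin N → ℝ → Euc d} {S : Set ℝ}
    (hX : ∀ i, ContinuousOn (X i) S) (i : Fin N) :
    ContinuousOn (fun s => truncField α δ (fun k => X k s) (X i s)) S := by
  have h : ContinuousOn (fun s => ∑ k, Ftrunc d α δ (X i s - X k s)) S :=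
    continuousOn_finsetSum _ fun j _ =>
      (continuous_Ftrunc hδ).comp_continuousOn ((hX i).sub (hX j))
  exact h.const_smul (N : ℝ)⁻¹

lemma average_nearField_le {d N : ℕ} (hN : 0 < N) {α β δ r ε CB t Q : ℝ} (hα : 0 < α)
    (hα1 : α < 1) (hr : 0 < r) (hrδ : r ≤ δ) (hε : 0 < ε) (hCB : 0 ≤ CB)
    {X : Fin N → ℝ → Euc d} (hX : ∀ i, ContinuousOn (X i) (Icc t (t + ε)))
    (hsep : ∀ i j, i ≠ j → ∀ s ∈ Icc t (t + ε), X i s ≠ X j s)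
    (hmove : ∀ i, ∀ s ∈ Icc t (t + ε), ‖X i s - X i t‖ ≤ CB * ε) (hεr : 2 * (CB * ε) ≤ r)
    (i : Fin N)
    (hdE : ∀ j, ε⁻¹ * ∫ s in t..(t + ε), ‖fieldAt (Fsing d α) X i s - fieldAt (Fsing d α) X j s‖
      / (ε ^ β + ‖X i s - X j s‖) ≤ CB)
    (hdoub : ((Finset.univ.filter fun j => ‖X j t - X i t‖ ≤ 4 * r).card : ℝ)
      ≤ Q * (Finset.univ.filter fun j => ‖X j t - X i t‖ ≤ r).card)
    (hlin : ∀ σ, 2 * r ≤ σ → σ ≤ 6 * δ →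
      ((Finset.univ.filter fun j => ‖X j t - X i t‖ ≤ σ).card : ℝ) ≤ N * σ) :
    ε⁻¹ * ∫ s in t..(t + ε), ‖nearField α δ (fun k => X k s) i‖ ≤
      Q * (6 * (dyadicConst α * δ ^ (1 - α)) + CB * (ε ^ β + 5 * r)
        + (2+α) * δ ^ (-(1+α)) * (5 * r)) := by
  classical
  have hδ : 0 < δ := hr.trans_le hrδ
  set A := Finset.univ.filter fun j => ‖X j t - X i t‖ ≤ r with hA
  set B := Finset.univ.filter fun j => ‖X j t - X i t‖ ≤ 4 * r with hB
  set L := (2+α) * δ ^ (-(1+α)) with hL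
  have hL0 : 0 ≤ L := by positivity
  have htε : t ≤ t + ε := by linarith
  have hεβ : 0 < ε ^ β := Real.rpow_pos_of_pos hε β
  have hAcard : (1:ℝ) ≤ A.card := by
    have : i ∈ A := by simp [hA, hr.le]
    exact_mod_cast Finset.card_pos.2 ⟨i, this⟩
  have hmv : ∀ j k, ∀ s ∈ Icc t (t + ε), ‖(X j s - X k s) - (X j t - X k t)‖ ≤ r := by
    intro j k s hs
    have h1 := hmove j s hs
    have h2 := hmove k s hs
    rw [sub_sub_sub_comm]
    refine (norm_sub_le _ _).trans ?_
    linarith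
  have hfwd : ∀ j k, ∀ s ∈ Icc t (t + ε), ‖X j s - X k s‖ ≤ ‖X j t - X k t‖ + r := by
    intro j k s hs
    have := norm_sub_norm_le (X j s - X k s) (X j t - X k t)
    linarith [hmv j k s hs]
  have hbwd : ∀ j k, ∀ s ∈ Icc t (t + ε), ‖X j t - X k t‖ ≤ ‖X j s - X k s‖ + r := by
    intro j k s hs
    have := norm_sub_norm_le (X j t - X k t) (X j s - X k s)
    rw [norm_sub_rev (X j t - X k t)] at this
    linarith [hmv j k s hs]
  let h : Fin N → ℝ → ℝ := fun j s =>
    ‖fieldAt (Fsing d α) X i s - fieldAt (Fsing d α) X j s‖ / (ε ^ β + ‖X i s - X j s‖)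
  have hpos : ∀ j s, 0 < ε ^ β + ‖X i s - X j s‖ := fun j s => by positivity
  have hhc : ∀ j, ContinuousOn (h j) (Icc t (t + ε)) := fun j =>
    ((continuousOn_fieldAt hX hsep i).sub (continuousOn_fieldAt hX hsep j)).norm.div
      (continuousOn_const.add ((hX i).sub (hX j)).norm) fun s _ => (hpos j s).ne'
  have hnear : ContinuousOn (fun s => nearField α δ (fun k => X k s) i) (Icc t (t + ε)) := by
    simp only [nearField_eq]
    exact (continuousOn_fieldAt hX hsep i).sub (continuousOn_truncField hδ hX i)
  have hpt : ∀ s ∈ Icc t (t + ε), A.card * ‖nearField α δ (fun k => X k s) i‖ ≤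
      B.card * (6 * (dyadicConst α * δ ^ (1 - α)) + L * (5 * r))
        + ∑ j ∈ B, (ε ^ β + 5 * r) * h j s := by
    intro s hs
    have hst := card_mul_norm_nearField_le hN hα hα1 hr hrδ (fun k => X k s) i A B
      (fun j hj => by
        have h1 := (Finset.mem_filter.1 hj).2
        linarith [hfwd j i s hs])
      (fun j hj => by
        refine Finset.mem_filter.2 ⟨Finset.mem_univ _, ?_⟩
        linarith [hbwd j i s hs])
      (fun j hj σ hσ hσδ => by
        refine le_trans ?_ (hlin (6 * σ) (by linarith) (by linarith))
        refine Nat.cast_le.2 (Finset.card_le_card fun k hk => ?_)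
        have hk := (Finset.mem_filter.1 hk).2
        refine Finset.mem_filter.2 ⟨Finset.mem_univ _, ?_⟩
        have h1 := (Finset.mem_filter.1 hj).2
        have h2 := hbwd j k s hs
        have h3 : ‖X k t - X i t‖ ≤ ‖X j t - X k t‖ + ‖X j t - X i t‖ := by
          rw [norm_sub_rev (X j t) (X k t)]
          exact norm_sub_le_norm_sub_add_norm_sub _ _ _
        linarith)
    refine hst.trans ?_
    rw [mul_add, add_assoc]
    gcongr
    rw [← nsmul_eq_mul, ← Finset.sum_const, ← Finset.sum_add_distrib]
    refine Finset.sum_le_sum fun j hj => ?_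
    have hij : ‖X i s - X j s‖ ≤ 5 * r := by
      have h1 := (Finset.mem_filter.1 hj).2
      rw [norm_sub_rev]
      linarith [hfwd j i s hs]
    have h1 : ‖fieldAt (Fsing d α) X i s - fieldAt (Fsing d α) X j s‖ ≤ (ε ^ β + 5 * r) * h j s := by
      have : ‖fieldAt (Fsing d α) X i s - fieldAt (Fsing d α) X j s‖
          = (ε ^ β + ‖X i s - X j s‖) * h j s := by
        simp only [h]; rw [mul_div_cancel₀ _ (hpos j s).ne']
      rw [this]
      gcongr
    have h2 := norm_truncField_sub_le hα hδ (fun k => X k s) (fun k => X k s) (norm_nonneg _)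
      (X i s) (X j s) (fun k => by rw [sub_sub_sub_cancel_right])
    have h3 : L * ‖X i s - X j s‖ ≤ L * (5 * r) := by gcongr
    rw [nearField_eq, nearField_eq, sub_sub_sub_comm]
    refine (norm_sub_le _ _).trans ?_
    linarith
  have hii : ∀ {g : ℝ → ℝ}, ContinuousOn g (Icc t (t + ε)) →
      IntervalIntegrable g volume t (t + ε) := fun hg => hg.intervalIntegrable_of_Icc htε
  have hwin : ∫ s in t..(t + ε), (A.card : ℝ) * ‖nearField α δ (fun k => X k s) i‖ ≤
      ∫ s in t..(t + ε), ((B.card : ℝ) * (6 * (dyadicConst α * δ ^ (1 - α)) + L * (5 * r))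
        + ∑ j ∈ B, (ε ^ β + 5 * r) * h j s) := intervalIntegral.integral_mono_on (μ := volume) htε
    (hii (continuousOn_const.mul hnear.norm))
    (hii (continuousOn_const.add (continuousOn_finsetSum _ fun j _ =>
      continuousOn_const.mul (hhc j)))) hpt
  have hS : ∀ j ∈ B, IntervalIntegrable (fun s => (ε ^ β + 5 * r) * h j s) volume t (t + ε) :=
    fun j _ => hii (continuousOn_const.mul (hhc j))
  have hS' : IntervalIntegrable (fun s => ∑ j ∈ B, (ε ^ β + 5 * r) * h j s) volume t (t + ε) :=
    hii (continuousOn_finsetSum _ fun j _ => continuousOn_const.mul (hhc j))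
  rw [intervalIntegral.integral_const_mul,
    intervalIntegral.integral_add (by simp) hS',
    intervalIntegral.integral_finsetSum hS,
    intervalIntegral.integral_const] at hwin
  simp only [intervalIntegral.integral_const_mul, add_sub_cancel_left, smul_eq_mul] at hwin
  have hsum : ∑ j ∈ B, (ε ^ β + 5 * r) * ∫ s in t..(t + ε), h j s
      ≤ B.card * ((ε ^ β + 5 * r) * (ε * CB)) := by
    rw [← nsmul_eq_mul]
    refine Finset.sum_le_card_nsmul _ _ _ fun j _ => ?_
    have := hdE j
    rw [inv_mul_le_iff₀ hε] at this
    gcongr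
  set P := 6 * (dyadicConst α * δ ^ (1 - α)) + CB * (ε ^ β + 5 * r) + L * (5 * r) with hP
  have hP0 : 0 ≤ P := by
    have := dyadicConst_pos hα1
    positivity
  set I := ∫ s in t..(t + ε), ‖nearField α δ (fun k => X k s) i‖ with hI
  have h1 : A.card * I ≤ B.card * (ε * P) := by
    rw [hP]; linarith
  have h2 : A.card * I ≤ A.card * (ε * (Q * P)) := by
    calc A.card * I ≤ B.card * (ε * P) := h1
      _ ≤ (Q * A.card) * (ε * P) := by gcongr
      _ = _ := by ring
  rw [inv_mul_le_iff₀ hε]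
  exact le_of_mul_le_mul_left h2 (by linarith)

lemma le_of_iSup_Icc_le {N : ℕ} {F : Fin N → ℝ → ℝ} {a b C : ℝ}
    (hF : ∀ i, BddAbove (F i '' Icc a b)) (h : ⨆ (i : Fin N) (t : Icc a b), F i (t : ℝ) ≤ C)
    (i : Fin N) {t : ℝ} (ht : t ∈ Icc a b) : F i t ≤ C := by
  refine le_trans ?_ (le_trans (le_ciSup (Set.finite_range _).bddAbove i) h)
  refine le_ciSup (f := fun t : Icc a b => F i (t : ℝ)) ?_ ⟨t, ht⟩
  obtain ⟨c, hc⟩ := hF i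
  exact ⟨c, by rintro _ ⟨u, rfl⟩; exact hc ⟨u, u.2, rfl⟩⟩

lemma bddAbove_norm_image_Icc {d : ℕ} {g : ℝ → Euc d} {a b : ℝ} (hg : ContinuousOn g (Icc a b)) :
    BddAbove ((fun t => ‖g t‖) '' Icc a b) :=
  (isCompact_Icc.image_of_continuousOn hg.norm).bddAbove

lemma average_le_of_dEbar_le {d N : ℕ} {α β T ε CB : ℝ} {X : Fin N → ℝ → Euc d} (hε : 0 < ε)
    (hεT : ε ≤ T) (hX : ∀ i, ContinuousOn (X i) (Icc 0 T))
    (hsep : ∀ i j, i ≠ j → ∀ s ∈ Icc 0 T, X i s ≠ X j s) (hCB : 0 ≤ CB)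
    (h : dEbar (Fsing d α) X ε β T ≤ CB) (i j : Fin N) {t : ℝ} (ht : t ∈ Icc 0 (T - ε)) :
    ε⁻¹ * ∫ s in t..(t + ε), ‖fieldAt (Fsing d α) X i s - fieldAt (Fsing d α) X j s‖
      / (ε ^ β + ‖X i s - X j s‖) ≤ CB := by
  by_cases hij : i = j
  · subst hij; simpa using hCB
  rw [dEbar, if_neg (not_lt.2 hεT)] at h
  have hεβ : 0 < ε ^ β := Real.rpow_pos_of_pos hε β
  let g : ℝ → ℝ := fun s => ‖fieldAt (Fsing d α) X i s - fieldAt (Fsing d α) X j s‖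
      / (ε ^ β + ‖X i s - X j s‖)
  have hgc : ContinuousOn g (Icc 0 T) :=
    ((continuousOn_fieldAt hX hsep i).sub (continuousOn_fieldAt hX hsep j)).norm.div
      (continuousOn_const.add ((hX i).sub (hX j)).norm) fun s _ => by positivity
  obtain ⟨H, hH⟩ := isCompact_Icc.exists_bound_of_continuousOn hgc
  have hbdd : BddAbove (range fun t : Icc (0:ℝ) (T - ε) =>
      ε⁻¹ * ∫ s in (t : ℝ)..((t : ℝ) + ε), g s) := by
    refine ⟨H, ?_⟩
    rintro _ ⟨⟨u, hu0, hu1⟩, rfl⟩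
    simp only
    rw [inv_mul_le_iff₀ hε]
    have := intervalIntegral.norm_integral_le_of_norm_le_const (a := u) (b := u + ε) (f := g)
      (C := H) (fun s hs => hH s (by
        rw [uIoc_of_le (by linarith)] at hs
        exact ⟨by linarith [hs.1], by linarith [hs.2]⟩))
    rw [add_sub_cancel_left, abs_of_pos hε] at this
    linarith [le_abs_self (∫ s in u..(u + ε), g s), Real.norm_eq_abs (∫ s in u..(u + ε), g s)]
  refine le_trans ?_ h
  refine le_trans ?_ (le_ciSup (Set.finite_range _).bddAbove i)
  refine le_trans ?_ (le_ciSup (Set.finite_range _).bddAbove j)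
  refine le_trans ?_ (le_ciSup (Set.finite_range _).bddAbove hij)
  exact le_ciSup hbdd ⟨t, ht⟩

lemma Rmax_zero_pos {d N : ℕ} (hN : 2 ≤ N) {X : Fin N → ℝ → Euc d}
    (hsep : ∀ i j, i ≠ j → X i 0 ≠ X j 0) : 0 < Rmax X 0 := by
  have : ∃ i, X i 0 ≠ 0 := by
    by_contra! h
    exact hsep ⟨0, by omega⟩ ⟨1, by omega⟩ (by simp) ((h _).trans (h _).symm)
  obtain ⟨i, hi⟩ := this
  refine (norm_pos_iff.2 hi).trans_le ?_
  refine le_of_iSup_Icc_le (F := fun i t => ‖X i t‖) (a := 0) (b := 0) (fun i => ?_) le_rfl i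
    (by simp)
  simp

lemma Rmax_zero_le {d N : ℕ} {X : Fin N → ℝ → Euc d} {C : ℝ} (hC : 0 ≤ C)
    (h : ∀ i, ‖X i 0‖ ≤ C) : Rmax X 0 ≤ C := by
  refine Real.iSup_le (fun i => Real.iSup_le (fun t => ?_) hC) hC
  obtain ⟨t, ht⟩ := t
  obtain rfl : t = 0 := le_antisymm ht.2 ht.1
  exact h i

open ContinuousLinearMap Convolution Topology in
/-- Equi-Lipschitz functions on `[0,T]` converging weakly converge almost everywhere. -/
lemma ae_tendsto_of_tendsto_integral_mul {T L : ℝ} {P : ℕ → ℝ → ℝ} {p : ℝ → ℝ} (hL : 0 ≤ L)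
    (hp : IntegrableOn p (Icc 0 T))
    (hP : ∀ᶠ N in atTop, ∀ s ∈ Icc 0 T, ∀ t ∈ Icc 0 T, |P N s - P N t| ≤ L * |s - t|)
    (hlim : ∀ θ : ℝ → ℝ, Continuous θ → HasCompactSupport θ →
      Tendsto (fun N => ∫ t in (0:ℝ)..T, θ t * P N t) atTop (𝓝 (∫ t in (0:ℝ)..T, θ t * p t))) :
    ∀ᵐ t, t ∈ Ioo 0 T → Tendsto (fun N => P N t) atTop (𝓝 (p t)) := by
  let φ : ℕ → ContDiffBump (0 : ℝ) := fun n =>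
    ⟨((n:ℝ) + 2)⁻¹, ((n:ℝ) + 1)⁻¹, by positivity, by gcongr; norm_num⟩
  have hφ0 : Tendsto (fun n => (φ n).rOut) atTop (𝓝 0) := by
    simpa only [one_div] using tendsto_one_div_add_atTop_nhds_zero_nat (𝕜 := ℝ)
  have hg : LocallyIntegrable ((Icc 0 T).indicator p) (volume : Measure ℝ) :=
    ((integrable_indicator_iff measurableSet_Icc).2 hp).locallyIntegrable
  have hae := ContDiffBump.ae_convolution_tendsto_right_of_locallyIntegrable (K := 2) hφ0
    (Eventually.of_forall fun n => by
      simp only [φ]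
      rw [← div_eq_mul_inv, inv_eq_one_div, div_le_div_iff₀ (by positivity) (by positivity)]
      linarith) hg
  filter_upwards [hae] with t ht htT
  rw [indicator_of_mem (Ioo_subset_Icc_self htT)] at ht
  rw [Metric.tendsto_atTop]
  intro τ hτ
  have hsmall : ∀ᶠ n in atTop, (φ n).rOut < min (min t (T - t)) (τ / (3 * (L + 1))) :=
    hφ0.eventually_lt_const (lt_min (lt_min htT.1 (by linarith [htT.2])) (by positivity))
  obtain ⟨n, hn1, hn2⟩ := (hsmall.and (Metric.tendsto_nhds.1 ht (τ / 3) (by positivity))).exists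
  set r := (φ n).rOut with hr
  have hr0 : 0 < r := (φ n).rOut_pos
  obtain ⟨hn1, hrτ⟩ := lt_min_iff.1 hn1
  obtain ⟨hrt, hrT⟩ := lt_min_iff.1 hn1
  let θ : ℝ → ℝ := fun s => (φ n).normed volume (t - s)
  have hθc : Continuous θ := (φ n).continuous_normed.comp (by fun_prop)
  have hθs : HasCompactSupport θ :=
    (φ n).hasCompactSupport_normed.comp_homeomorph (Homeomorph.subLeft t)
  have hθ0 : ∀ s, 0 ≤ θ s := fun s => (φ n).nonneg_normed _
  have hθz : ∀ s, r ≤ |s - t| → θ s = 0 := by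
    intro s hs
    by_contra h
    have : t - s ∈ Function.support ((φ n).normed volume) := h
    rw [(φ n).support_normed_eq, mem_ball_zero_iff, Real.norm_eq_abs, abs_sub_comm] at this
    linarith
  have hθout : ∀ s, s ∉ Ioc 0 T → θ s = 0 := by
    intro s hs
    refine hθz s ?_
    by_contra! h
    have := abs_lt.1 h
    exact hs ⟨by linarith, by linarith⟩
  have hIoc : ∀ u : ℝ → ℝ, ∫ s in (0:ℝ)..T, θ s * u s = ∫ s, θ s * u s := by
    intro u
    rw [intervalIntegral.integral_of_le (by linarith [htT.1, htT.2])]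
    refine setIntegral_eq_integral_of_forall_compl_eq_zero fun s hs => ?_
    rw [hθout s hs, zero_mul]
  have hconv : ((φ n).normed volume ⋆[lsmul ℝ ℝ, volume] (Icc 0 T).indicator p) t
      = ∫ s in (0:ℝ)..T, θ s * p s := by
    rw [convolution_eq_swap, hIoc]
    refine integral_congr_ae (Eventually.of_forall fun s => ?_)
    simp only [lsmul_apply, smul_eq_mul, θ]
    by_cases hs : s ∈ Icc 0 T
    · rw [indicator_of_mem hs]
    · have : (φ n).normed volume (t - s) = 0 := hθout s fun h => hs (Ioc_subset_Icc_self h)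
      rw [this, zero_mul, zero_mul]
  have hθ1 : ∫ s, θ s = 1 := by
    simp only [θ]
    rw [integral_sub_left_eq_self (fun s => (φ n).normed volume s)]
    exact (φ n).integral_normed
  rw [hconv] at hn2
  obtain ⟨N₀, hN₀⟩ := Filter.eventually_atTop.1
    ((Metric.tendsto_nhds.1 (hlim θ hθc hθs) (τ / 3) (by positivity)).and hP)
  refine ⟨N₀, fun N hN => ?_⟩
  obtain ⟨h1, h2⟩ := hN₀ N hN
  have hPc : ContinuousOn (P N) (Icc 0 T) := by
    refine LipschitzOnWith.continuousOn (K := ⟨L, hL⟩) ?_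
    refine LipschitzOnWith.of_dist_le_mul fun x hx y hy => h2 x hx y hy
  have h3 : |P N t - ∫ s in (0:ℝ)..T, θ s * P N s| ≤ L * r := by
    have e1 : P N t = ∫ s in (0:ℝ)..T, θ s * P N t := by
      rw [hIoc fun _ => P N t, integral_mul_const, hθ1, one_mul]
    have hT0 : (0:ℝ) ≤ T := by linarith [htT.1, htT.2]
    have i1 : IntervalIntegrable (fun s => θ s * P N t) volume 0 T :=
      (hθc.mul continuous_const).intervalIntegrable _ _
    have i2 : IntervalIntegrable (fun s => θ s * P N s) volume 0 T :=
      (hθc.continuousOn.mul hPc).intervalIntegrable_of_Icc hT0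
    have i3 : IntervalIntegrable (fun s => θ s * (L * r)) volume 0 T :=
      (hθc.mul continuous_const).intervalIntegrable _ _
    have e2 : P N t - ∫ s in (0:ℝ)..T, θ s * P N s
        = ∫ s in (0:ℝ)..T, (θ s * P N t - θ s * P N s) := by
      rw [intervalIntegral.integral_sub i1 i2, ← e1]
    have e3 : ∫ s in (0:ℝ)..T, θ s * (L * r) = L * r := by
      rw [hIoc fun _ => L * r, integral_mul_const, hθ1, one_mul]
    rw [e2, ← Real.norm_eq_abs]
    refine (intervalIntegral.norm_integral_le_integral_norm hT0).trans ?_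
    rw [← e3]
    refine intervalIntegral.integral_mono_on hT0 (i1.sub i2).norm i3 fun s hs => ?_
    rw [← mul_sub, norm_mul, Real.norm_of_nonneg (hθ0 s), Real.norm_eq_abs]
    by_cases hsr : r ≤ |s - t|
    · rw [hθz s hsr, zero_mul, zero_mul]
    · refine mul_le_mul_of_nonneg_left ?_ (hθ0 s)
      refine (h2 t (Ioo_subset_Icc_self htT) s hs).trans ?_
      rw [abs_sub_comm]
      gcongr
      exact (not_le.1 hsr).le
  have h4 : L * r ≤ τ / 3 := by
    have : r * (3 * (L + 1)) < τ := (lt_div_iff₀ (by positivity)).1 hrτ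
    nlinarith
  rw [Real.dist_eq] at *
  have h5 := abs_le.1 h3
  have h6 := abs_lt.1 h1
  have h7 := abs_lt.1 hn2
  rw [abs_lt]
  constructor <;> linarith

/-- A continuous cutoff, equal to `1` on the ball of radius `R` and to `0` off that of radius
`R + 1`. -/
def cutoff {E : Type*} [NormedAddCommGroup E] (R : ℝ) (x : E) : ℝ := max 0 (min 1 (R + 1 - ‖x‖))

lemma continuous_cutoff {E : Type*} [NormedAddCommGroup E] (R : ℝ) :
    Continuous (cutoff R : E → ℝ) := by
  unfold cutoff; fun_prop

lemma cutoff_eq_one {E : Type*} [NormedAddCommGroup E] {R : ℝ} {x : E} (h : ‖x‖ ≤ R) :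
    cutoff R x = 1 := by
  rw [cutoff, min_eq_left (by linarith), max_eq_right zero_le_one]

lemma cutoff_eq_zero {E : Type*} [NormedAddCommGroup E] {R : ℝ} {x : E} (h : R + 1 < ‖x‖) :
    cutoff R x = 0 := by
  rw [cutoff, max_eq_left ((min_le_right _ _).trans (by linarith))]

lemma hasCompactSupport_cutoff {E : Type*} [NormedAddCommGroup E] [ProperSpace E] (R : ℝ) :
    HasCompactSupport (cutoff R : E → ℝ) :=
  HasCompactSupport.intro (isCompact_closedBall (0 : E) (R + 1)) fun x hx =>
    cutoff_eq_zero (by simpa using hx)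

/-- Particle systems with positions and velocities bounded by `CB` on `[0,T]`, whose empirical
measures converge weakly to `f`. -/
structure WeakLimit {d : ℕ} (T CB : ℝ) (X V : (N : ℕ) → Fin N → ℝ → Euc d)
    (f : ℝ → Phase d → ℝ) : Prop where
  pos : 0 < T
  nonneg : 0 ≤ CB
  contX : ∀ N, 2 ≤ N → ∀ i, ContinuousOn (X N i) (Icc 0 T)
  contV : ∀ N, 2 ≤ N → ∀ i, ContinuousOn (V N i) (Icc 0 T)
  boundX : ∀ N, 2 ≤ N → ∀ i, ∀ t ∈ Icc 0 T, ‖X N i t‖ ≤ CB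
  boundV : ∀ N, 2 ≤ N → ∀ i, ∀ t ∈ Icc 0 T, ‖V N i t‖ ≤ CB
  move : ∀ N, 2 ≤ N → ∀ i, ∀ s ∈ Icc 0 T, ∀ t ∈ Icc 0 T, ‖X N i s - X N i t‖ ≤ CB * |s - t|
  meas : ∀ t, Measurable (f t)
  nonneg_density : ∀ t z, 0 ≤ f t z
  integrable : ∀ t ∈ Icc (0:ℝ) T, Integrable (f t) (volume : Measure (Phase d))
  lim : ∀ g : ℝ × Phase d → ℝ, Continuous g → HasCompactSupport g →
      Tendsto
        (fun N => ∫ t in (0:ℝ)..T, ∫ z, g (t, z) ∂(empMeas (X N) (V N) t))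
        atTop (nhds (∫ t in (0:ℝ)..T, ∫ z, g (t, z) * f t z))

/-- Average of an observable over the particles. -/
def obs {d N : ℕ} (X V : Fin N → ℝ → Euc d) (φ : Phase d → ℝ) (t : ℝ) : ℝ :=
  (N : ℝ)⁻¹ * ∑ i, φ (X i t, V i t)

lemma integrable_mul_of_bounded {d : ℕ} {F : Phase d → ℝ} (hF : Integrable F)
    {φ : Phase d → ℝ} (hφ : Continuous φ) {C : ℝ} (hC : ∀ z, |φ z| ≤ C) :
    Integrable (fun z => φ z * F z) :=
  hF.bdd_mul (c := C) hφ.aestronglyMeasurable (Eventually.of_forall hC)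

lemma exists_abs_le_of_hasCompactSupport {d : ℕ} {φ : Phase d → ℝ} (hφ : Continuous φ)
    (hs : HasCompactSupport φ) : ∃ C, ∀ z, |φ z| ≤ C :=
  hs.exists_bound_of_continuous hφ

namespace WeakLimit

variable {d : ℕ} {T CB : ℝ} {X V : (N : ℕ) → Fin N → ℝ → Euc d} {f : ℝ → Phase d → ℝ}

lemma integrable_mul (h : WeakLimit T CB X V f) {φ : Phase d → ℝ} (hφ : Continuous φ)
    (hs : HasCompactSupport φ) {t : ℝ} (ht : t ∈ Icc 0 T) :
    Integrable (fun z => φ z * f t z) := by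
  obtain ⟨C, hC⟩ := exists_abs_le_of_hasCompactSupport hφ hs
  exact integrable_mul_of_bounded (h.integrable t ht) hφ hC

lemma continuousOn_obs (h : WeakLimit T CB X V f) {φ : Phase d → ℝ} (hφ : Continuous φ)
    {N : ℕ} (hN : 2 ≤ N) : ContinuousOn (obs (X N) (V N) φ) (Icc 0 T) := by
  unfold obs
  refine continuousOn_const.mul (continuousOn_finsetSum _ fun i _ => ?_)
  exact hφ.comp_continuousOn ((h.contX N hN i).prodMk (h.contV N hN i))

lemma tendsto_integral_mul_obs (h : WeakLimit T CB X V f) {φ : Phase d → ℝ} (hφ : Continuous φ)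
    (hs : HasCompactSupport φ) {θ : ℝ → ℝ} (hθ : Continuous θ) (hθs : HasCompactSupport θ) :
    Tendsto (fun N => ∫ t in (0:ℝ)..T, θ t * obs (X N) (V N) φ t) atTop
      (nhds (∫ t in (0:ℝ)..T, θ t * ∫ z, φ z * f t z)) := by
  have := h.lim (fun p => θ p.1 * φ p.2) (by fun_prop)
    (HasCompactSupport.intro (hθs.isCompact.prod hs.isCompact) fun p hp => by
      rw [mem_prod, not_and_or] at hp
      rcases hp with hp | hp
      · simp [image_eq_zero_of_notMem_tsupport hp]
      · simp [image_eq_zero_of_notMem_tsupport hp])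
  simp only [integral_empMeas, mul_assoc, integral_const_mul] at this
  simpa only [obs, mul_left_comm] using this

lemma tendsto_integral_obs (h : WeakLimit T CB X V f) {φ : Phase d → ℝ} (hφ : Continuous φ)
    (hs : HasCompactSupport φ) :
    Tendsto (fun N => ∫ t in (0:ℝ)..T, obs (X N) (V N) φ t) atTop
      (nhds (∫ t in (0:ℝ)..T, ∫ z, φ z * f t z)) := by
  have := h.tendsto_integral_mul_obs hφ hs (continuous_cutoff T) (hasCompactSupport_cutoff T)
  have key : ∀ u : ℝ → ℝ, ∫ t in (0:ℝ)..T, cutoff T t * u t = ∫ t in (0:ℝ)..T, u t := by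
    intro u
    refine intervalIntegral.integral_congr fun t ht => ?_
    rw [uIcc_of_le h.pos.le] at ht
    rw [cutoff_eq_one (by rw [Real.norm_of_nonneg ht.1]; exact ht.2), one_mul]
  simpa only [key] using this

lemma intervalIntegrable_integral_mul (h : WeakLimit T CB X V f) {φ : Phase d → ℝ}
    (hφ : Continuous φ) (hs : HasCompactSupport φ) :
    IntervalIntegrable (fun t => ∫ z, φ z * f t z) volume 0 T := by
  have hχc := continuous_cutoff (E := Phase d) CB
  have hχs := hasCompactSupport_cutoff (E := Phase d) CB
  have hone : ∀ N, 2 ≤ N → ∀ t ∈ Icc 0 T, obs (X N) (V N) (cutoff CB) t = 1 := by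
    intro N hN t ht
    have : ∀ i, cutoff CB (X N i t, V N i t) = 1 := fun i =>
      cutoff_eq_one (max_le (h.boundX N hN i t ht) (h.boundV N hN i t ht))
    have hN' : (N:ℝ) ≠ 0 := by positivity
    simp [obs, this, hN']
  have hintT : ∀ N, 2 ≤ N → ∫ t in (0:ℝ)..T, obs (X N) (V N) (cutoff CB) t = T := by
    intro N hN
    rw [intervalIntegral.integral_congr (g := fun _ => (1:ℝ)) fun t ht =>
      hone N hN t (by rwa [uIcc_of_le h.pos.le] at ht)]
    simp
  have hne : ∀ {ψ : Phase d → ℝ}, Continuous ψ → HasCompactSupport ψ →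
      Tendsto (fun N => ∫ t in (0:ℝ)..T, obs (X N) (V N) ψ t) atTop (nhds T) →
      IntervalIntegrable (fun t => ∫ z, ψ z * f t z) volume 0 T := by
    intro ψ hψ hψs hlim
    by_contra hcon
    have h1 := tendsto_nhds_unique hlim (h.tendsto_integral_obs hψ hψs)
    rw [intervalIntegral.integral_undef hcon] at h1
    exact h.pos.ne' h1
  have hχlim : Tendsto (fun N => ∫ t in (0:ℝ)..T, obs (X N) (V N) (cutoff CB) t) atTop (nhds T) :=
    tendsto_const_nhds.congr' (by
      filter_upwards [eventually_ge_atTop 2] with N hN using (hintT N hN).symm)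
  have hχ := hne hχc hχs hχlim
  by_contra hcon
  have hφlim := h.tendsto_integral_obs hφ hs
  rw [intervalIntegral.integral_undef hcon] at hφlim
  have hsum : IntervalIntegrable (fun t => ∫ z, (φ z + cutoff CB z) * f t z) volume 0 T := by
    refine hne (hφ.add hχc) (hs.add hχs) ?_
    have := hφlim.add hχlim
    rw [zero_add] at this
    refine this.congr' ?_
    filter_upwards [eventually_ge_atTop 2] with N hN
    rw [← intervalIntegral.integral_add
      ((h.continuousOn_obs hφ hN).intervalIntegrable_of_Icc h.pos.le)
      ((h.continuousOn_obs hχc hN).intervalIntegrable_of_Icc h.pos.le)]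
    refine intervalIntegral.integral_congr fun t _ => ?_
    simp only [obs, Finset.sum_add_distrib, mul_add]
  refine hcon ((hsum.sub hχ).congr fun t ht => ?_)
  rw [uIoc_of_le h.pos.le] at ht
  have ht' := Ioc_subset_Icc_self ht
  simp only [add_mul]
  rw [integral_add (h.integrable_mul hφ hs ht') (h.integrable_mul hχc hχs ht')]
  ring

lemma ae_tendsto_obs (h : WeakLimit T CB X V f) {φ : Phase d → ℝ} (hφ : Continuous φ)
    (hs : HasCompactSupport φ) {L : ℝ} (hL : 0 ≤ L)
    (hLip : ∀ N, 2 ≤ N → ∀ s ∈ Icc 0 T, ∀ t ∈ Icc 0 T,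
      |obs (X N) (V N) φ s - obs (X N) (V N) φ t| ≤ L * |s - t|) :
    ∀ᵐ t, t ∈ Ioo 0 T → Tendsto (fun N => obs (X N) (V N) φ t) atTop
      (nhds (∫ z, φ z * f t z)) := by
  refine ae_tendsto_of_tendsto_integral_mul hL ?_ ?_ fun θ hθ hθs =>
    h.tendsto_integral_mul_obs hφ hs hθ hθs
  · exact (intervalIntegrable_iff_integrableOn_Icc_of_le h.pos.le).1
      (h.intervalIntegrable_integral_mul hφ hs)
  · filter_upwards [eventually_ge_atTop 2] with N hN using hLip N hN

/-- The limit density vanishes where no particle goes. -/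
lemma ae_eq_zero (h : WeakLimit T CB X V f) :
    ∀ᵐ t, t ∈ Ioo 0 T → ∀ᵐ z, CB < ‖z‖ → f t z = 0 := by
  let φ : ℕ → Phase d → ℝ := fun n z => max 0 (min (‖z‖ - CB) (n + 1 + CB - ‖z‖))
  have hφc : ∀ n, Continuous (φ n) := fun n => by simp only [φ]; fun_prop
  have hφs : ∀ n, HasCompactSupport (φ n) := fun n =>
    HasCompactSupport.intro (isCompact_closedBall (0 : Phase d) (n + 1 + CB)) fun x hx => by
      have : (n:ℝ) + 1 + CB < ‖x‖ := by simpa using hx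
      exact max_eq_left ((min_le_right _ _).trans (by linarith))
  have hz : ∀ n N, 2 ≤ N → ∀ t ∈ Icc 0 T, obs (X N) (V N) (φ n) t = 0 := by
    intro n N hN t ht
    have : ∀ i, φ n (X N i t, V N i t) = 0 := fun i => by
      have h1 : ‖(X N i t, V N i t)‖ ≤ CB := max_le (h.boundX N hN i t ht) (h.boundV N hN i t ht)
      exact max_eq_left ((min_le_left _ _).trans (by linarith))
    simp [obs, this]
  have hae : ∀ᵐ t, ∀ n, t ∈ Ioo 0 T → Tendsto (fun N => obs (X N) (V N) (φ n) t) atTop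
      (nhds (∫ z, φ n z * f t z)) :=
    ae_all_iff.2 fun n => h.ae_tendsto_obs (hφc n) (hφs n) le_rfl fun N hN s hs t ht => by
      rw [hz n N hN s hs, hz n N hN t ht]; simp
  filter_upwards [hae] with t ht htT
  have htI := Ioo_subset_Icc_self htT
  have h0 : ∀ n, ∀ᵐ z, φ n z * f t z = 0 := by
    intro n
    have h1 : ∫ z, φ n z * f t z = 0 := by
      refine tendsto_nhds_unique (ht n htT) (tendsto_const_nhds.congr' ?_)
      filter_upwards [eventually_ge_atTop 2] with N hN using (hz n N hN t htI).symm
    exact (integral_eq_zero_iff_of_nonneg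
      (fun z => mul_nonneg (le_max_left _ _) (h.nonneg_density t z))
      (h.integrable_mul (hφc n) (hφs n) htI)).1 h1
  filter_upwards [ae_all_iff.2 h0] with z hz hzn
  obtain ⟨n, hn⟩ := exists_nat_gt (‖z‖ - CB)
  have h2 : 0 < φ n z := lt_max_of_lt_right (lt_min (by linarith) (by linarith))
  exact (mul_eq_zero.1 (hz n)).resolve_left h2.ne'

/-- Almost everywhere convergence of Lipschitz observables of the positions. -/
lemma ae_tendsto_obs_fst (h : WeakLimit T CB X V f) {ψ : Euc d → ℝ} {L : ℝ} (hL : 0 ≤ L)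
    (hψ : ∀ x y, |ψ x - ψ y| ≤ L * ‖x - y‖) :
    ∀ᵐ t, t ∈ Ioo 0 T → Tendsto (fun N : ℕ => (N:ℝ)⁻¹ * ∑ i, ψ (X N i t)) atTop
      (nhds (∫ z, ψ z.1 * f t z)) := by
  have hψc : Continuous ψ :=
    (LipschitzWith.of_dist_le_mul (K := ⟨L, hL⟩) fun x y => by
      rw [dist_eq_norm x y]; exact hψ x y).continuous
  let φ : Phase d → ℝ := fun z => ψ z.1 * cutoff CB z
  have hφc : Continuous φ := (hψc.comp continuous_fst).mul (continuous_cutoff CB)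
  have hφs : HasCompactSupport φ := (hasCompactSupport_cutoff CB).mul_left
  have heq : ∀ N, 2 ≤ N → ∀ t ∈ Icc 0 T,
      obs (X N) (V N) φ t = (N:ℝ)⁻¹ * ∑ i, ψ (X N i t) := by
    intro N hN t ht
    unfold obs
    congr 1
    refine Finset.sum_congr rfl fun i _ => ?_
    simp only [φ]
    rw [cutoff_eq_one (max_le (h.boundX N hN i t ht) (h.boundV N hN i t ht)), mul_one]
  have hmain := h.ae_tendsto_obs hφc hφs (L := L * CB) (mul_nonneg hL h.nonneg)
    fun N hN s hs t ht => by
      rw [heq N hN s hs, heq N hN t ht, ← mul_sub, ← Finset.sum_sub_distrib, abs_mul,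
        abs_of_nonneg (by positivity), inv_mul_le_iff₀ (by positivity)]
      refine (Finset.abs_sum_le_sum_abs _ _).trans ?_
      refine (Finset.sum_le_card_nsmul _ _ (L * CB * |s - t|) fun i _ => ?_).trans_eq (by simp)
      refine (hψ _ _).trans ?_
      rw [mul_assoc]
      gcongr
      exact h.move N hN i s hs t ht
  filter_upwards [hmain, h.ae_eq_zero] with t h1 h2 htT
  have h3 : ∫ z, φ z * f t z = ∫ z, ψ z.1 * f t z := by
    refine integral_congr_ae ?_
    filter_upwards [h2 htT] with z hz
    by_cases hzn : CB < ‖z‖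
    · simp [hz hzn]
    · simp only [φ]
      rw [cutoff_eq_one (not_lt.1 hzn), mul_one]
  rw [← h3]
  refine (h1 htT).congr' ?_
  filter_upwards [eventually_ge_atTop 2] with N hN using heq N hN t (Ioo_subset_Icc_self htT)

end WeakLimit

/-- Equi-Lipschitz functions converging pointwise on a totally bounded set converge uniformly. -/
lemma eventually_forall_dist_le_of_totallyBounded {Z E : Type*} [PseudoMetricSpace Z]
    [PseudoMetricSpace E] {S : Set Z} (hS : TotallyBounded S) {H : ℕ → Z → E} {H' : Z → E} {L : ℝ}
    (hL : 0 ≤ L)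
    (hLip : ∀ᶠ N in atTop, ∀ z ∈ S, ∀ w ∈ S, dist (H N z) (H N w) ≤ L * dist z w)
    (hlim : ∀ z ∈ S, Tendsto (fun N => H N z) atTop (nhds (H' z))) {τ : ℝ} (hτ : 0 < τ) :
    ∀ᶠ N in atTop, ∀ z ∈ S, dist (H N z) (H' z) ≤ τ := by
  have hLip' : ∀ z ∈ S, ∀ w ∈ S, dist (H' z) (H' w) ≤ L * dist z w := fun z hz w hw =>
    le_of_tendsto ((hlim z hz).dist (hlim w hw)) (by
      filter_upwards [hLip] with N hN using hN z hz w hw)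
  obtain ⟨A, hAS, hAf, hA⟩ := finite_approx_of_totallyBounded hS (τ / (3 * (L + 1)))
    (by positivity)
  have hev : ∀ᶠ N in atTop, ∀ a ∈ A, dist (H N a) (H' a) < τ / 3 :=
    (Filter.eventually_all_finite hAf).2 fun a ha =>
      Metric.tendsto_nhds.1 (hlim a (hAS ha)) _ (by positivity)
  filter_upwards [hev, hLip] with N hN hNL z hz
  obtain ⟨a, ha, hza⟩ := mem_iUnion₂.1 (hA hz)
  have h1 := hNL z hz a (hAS ha)
  have h2 := hLip' a (hAS ha) z hz
  have h3 := hN a ha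
  rw [mem_ball] at hza
  have h4 : L * dist z a ≤ τ / 3 := by
    have h5 := (lt_div_iff₀ (by positivity)).1 hza
    nlinarith [dist_nonneg (x := z) (y := a)]
  rw [dist_comm a z] at h2
  linarith [dist_triangle4 (H N z) (H N a) (H' a) (H' z)]

lemma integrable_smul_Ftrunc {d : ℕ} {F : Phase d → ℝ} (hF : Integrable F) {α δ : ℝ} (hα : 0 < α)
    (hδ : 0 < δ) (x : Euc d) : Integrable fun w : Phase d => F w • Ftrunc d α δ (x - w.1) := by
  have hc : Continuous fun w : Phase d => Ftrunc d α δ (x - w.1) :=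
    (continuous_Ftrunc hδ).comp (by fun_prop)
  exact hF.smul_bdd (δ ^ (-α)) hc.aestronglyMeasurable
    (Eventually.of_forall fun w => norm_Ftrunc_le hα hδ _)

lemma norm_integral_smul_Fsing_sub_le {d : ℕ} {F : Phase d → ℝ} (hF : Measurable F)
    (hF0 : ∀ z, 0 ≤ F z) (hFi : Integrable F) {α δ C : ℝ} (hα : 0 < α) (hα1 : α < 1) (hδ : 0 < δ)
    (hC : 0 ≤ C) (x : Euc d)
    (hmass : ∀ σ, 0 < σ → σ ≤ δ →
      ∫⁻ z in {z : Phase d | ‖x - z.1‖ ≤ σ}, ENNReal.ofReal (F z) ≤ ENNReal.ofReal (C * σ)) :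
    ‖(∫ w : Phase d, F w • Fsing d α (x - w.1)) - ∫ w : Phase d, F w • Ftrunc d α δ (x - w.1)‖
      ≤ C * (dyadicConst α * δ ^ (1 - α)) := by
  have hms : ∀ σ : ℝ, MeasurableSet {z : Phase d | ‖x - z.1‖ ≤ σ} := fun σ =>
    measurableSet_le (by fun_prop) measurable_const
  have hdy := dyadicConst_pos hα1
  let ν := (volume : Measure (Phase d)).withDensity fun z => ENNReal.ofReal (F z)
  have hν := setLIntegral_rpow_neg_le (ν := ν) (ξ := fun z : Phase d => ‖x - z.1‖) (by fun_prop)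
    (fun _ => norm_nonneg _) hα hα1 hδ (M := ENNReal.ofReal C) fun σ h0 hσ => by
      rw [withDensity_apply _ (hms σ), ← ENNReal.ofReal_mul hC]
      exact hmass σ h0 hσ
  rw [← ENNReal.ofReal_mul hC, setLIntegral_withDensity_eq_setLIntegral_mul _ (by fun_prop)
    (by fun_prop) (hms δ)] at hν
  let g : Phase d → Euc d := fun w => F w • (Fsing d α (x - w.1) - Ftrunc d α δ (x - w.1))
  have hT : Measurable (Ftrunc d α δ) := (continuous_Ftrunc hδ).measurable
  have hS : Measurable (Fsing d α) := measurable_Fsing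
  have hgm : Measurable g := by
    have h1 : Measurable fun w : Phase d => x - w.1 := by fun_prop
    exact hF.smul ((hS.comp h1).sub (hT.comp h1))
  have hg : ∫⁻ w, ‖g w‖ₑ ≤ ENNReal.ofReal (C * (dyadicConst α * δ ^ (1 - α))) := by
    refine le_trans ?_ hν
    rw [← lintegral_indicator (hms δ)]
    refine lintegral_mono fun w => ?_
    by_cases hw : ‖x - w.1‖ ≤ δ
    · rw [indicator_of_mem (by exact hw), Pi.mul_apply, ← ENNReal.ofReal_mul (hF0 w),
        ← ofReal_norm]
      refine ENNReal.ofReal_le_ofReal ?_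
      simp only [g]
      rw [norm_smul, Real.norm_of_nonneg (hF0 w)]
      exact mul_le_mul_of_nonneg_left (norm_Fsing_sub_Ftrunc_le hα _) (hF0 w)
    · simp only [g]
      rw [Fsing_sub_Ftrunc_of_le (not_le.1 hw).le]
      simp
  have hgi : Integrable g :=
    ⟨hgm.aestronglyMeasurable, hg.trans_lt ENNReal.ofReal_lt_top⟩
  have hTi : Integrable fun w : Phase d => F w • Ftrunc d α δ (x - w.1) :=
    integrable_smul_Ftrunc hFi hα hδ x
  have hadd : (∫ w : Phase d, F w • Fsing d α (x - w.1))
      = (∫ w, g w) + ∫ w : Phase d, F w • Ftrunc d α δ (x - w.1) := by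
    rw [← integral_add hgi hTi]
    refine integral_congr_ae (Eventually.of_forall fun w => ?_)
    simp only [g]
    rw [← smul_add, sub_add_cancel]
  rw [hadd, add_sub_cancel_right]
  rw [← ENNReal.ofReal_le_ofReal_iff (by positivity), ofReal_norm]
  exact (enorm_integral_le_lintegral_enorm g).trans hg

/-- A tent function at scale `σ` around `x`. -/
def tent {d : ℕ} (x : Euc d) (σ : ℝ) (y : Euc d) : ℝ := max 0 (min 1 (2 - ‖x - y‖ / σ))

lemma tent_nonneg {d : ℕ} (x : Euc d) (σ : ℝ) (y : Euc d) : 0 ≤ tent x σ y := le_max_left _ _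

lemma tent_le_one {d : ℕ} (x : Euc d) (σ : ℝ) (y : Euc d) : tent x σ y ≤ 1 :=
  max_le zero_le_one (min_le_left _ _)

lemma tent_eq_one {d : ℕ} {x : Euc d} {σ : ℝ} (hσ : 0 < σ) {y : Euc d} (h : ‖x - y‖ ≤ σ) :
    tent x σ y = 1 := by
  have : ‖x - y‖ / σ ≤ 1 := (div_le_one hσ).2 h
  rw [tent, min_eq_left (by linarith), max_eq_right zero_le_one]

lemma tent_eq_zero {d : ℕ} {x : Euc d} {σ : ℝ} (hσ : 0 < σ) {y : Euc d} (h : 2 * σ < ‖x - y‖) :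
    tent x σ y = 0 := by
  have : 2 < ‖x - y‖ / σ := (lt_div_iff₀ hσ).2 h
  exact max_eq_left ((min_le_right _ _).trans (by linarith))

lemma abs_tent_sub_le {d : ℕ} {x : Euc d} {σ : ℝ} (hσ : 0 < σ) (y z : Euc d) :
    |tent x σ y - tent x σ z| ≤ σ⁻¹ * ‖y - z‖ := by
  have h1 : |tent x σ y - tent x σ z| ≤ |(2 - ‖x - y‖ / σ) - (2 - ‖x - z‖ / σ)| := by
    unfold tent
    refine (abs_max_sub_max_le_max _ _ _ _).trans (max_le (by simp) ?_)
    exact (abs_min_sub_min_le_max _ _ _ _).trans (max_le (by simp) le_rfl)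
  refine h1.trans ?_
  rw [sub_sub_sub_cancel_left, ← sub_div, abs_div, abs_of_pos hσ, div_eq_inv_mul]
  gcongr
  refine (abs_norm_sub_norm_le _ _).trans_eq ?_
  rw [sub_sub_sub_cancel_left]

lemma continuous_tent {d : ℕ} (x : Euc d) (σ : ℝ) : Continuous (tent x σ) := by
  unfold tent; fun_prop

namespace WeakLimit

variable {d : ℕ} {T CB : ℝ} {X V : (N : ℕ) → Fin N → ℝ → Euc d} {f : ℝ → Phase d → ℝ}

/-- The limit density inherits the growth bound on the mass of small balls. -/
lemma ae_mass_ball_le (h : WeakLimit T CB X V f) {C : ℝ} (hC : 0 ≤ C)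
    (hcard : ∀ σ, 0 < σ → σ ≤ 1 → ∀ᶠ N in atTop, ∀ t ∈ Icc 0 T, ∀ x : Euc d,
      ((Finset.univ.filter fun j => ‖X N j t - x‖ ≤ σ).card : ℝ) ≤ N * (C * σ ^ 2)) :
    ∀ᵐ t, t ∈ Ioo 0 T → ∀ (x : Euc d) (σ : ℝ), 0 < σ → σ ≤ 1 / 6 →
      ∫⁻ z in {z : Phase d | ‖x - z.1‖ ≤ σ}, ENNReal.ofReal (f t z)
        ≤ ENNReal.ofReal (36 * C * σ) := by
  let D := TopologicalSpace.denseSeq (Euc d)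
  have hae : ∀ᵐ t, ∀ p : ℕ × ℚ, 0 < p.2 → t ∈ Ioo 0 T →
      Tendsto (fun N : ℕ => (N:ℝ)⁻¹ * ∑ i, tent (D p.1) p.2 (X N i t)) atTop
        (nhds (∫ z, tent (D p.1) p.2 z.1 * f t z)) := by
    refine ae_all_iff.2 fun p => ?_
    by_cases hp : 0 < p.2
    · have hp' : (0:ℝ) < p.2 := by exact_mod_cast hp
      filter_upwards [h.ae_tendsto_obs_fst (by positivity) (abs_tent_sub_le (x := D p.1) hp')]
        with t ht _ htT using ht htT
    · exact Eventually.of_forall fun t hp' => absurd hp' hp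
  filter_upwards [hae] with t ht htT x σ hσ hσ6
  have htI := Ioo_subset_Icc_self htT
  obtain ⟨n, hn⟩ := (TopologicalSpace.denseRange_denseSeq (Euc d)).exists_dist_lt x hσ
  obtain ⟨ρ, hρ1, hρ2⟩ := exists_rat_btwn (show 2 * σ < 3 * σ by linarith)
  have hρ0 : (0:ℝ) < ρ := by linarith
  have hlim := ht (n, ρ) (by exact_mod_cast hρ0) htT
  simp only at hlim
  have hle : ∫ z, tent (D n) ρ z.1 * f t z ≤ C * (2 * ρ) ^ 2 := by
    refine le_of_tendsto hlim ?_
    filter_upwards [hcard (2 * ρ) (by linarith) (by linarith), eventually_ge_atTop 2] with N hN hN2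
    rw [inv_mul_le_iff₀ (by positivity)]
    refine le_trans ?_ (hN t htI (D n))
    rw [Finset.card_filter, Nat.cast_sum]
    refine Finset.sum_le_sum fun i _ => ?_
    split_ifs with hi
    · simpa using tent_le_one _ _ _
    · rw [tent_eq_zero hρ0 (by rw [norm_sub_rev]; exact not_le.1 hi)]; simp
  have h_intble : Integrable fun z => tent (D n) ρ z.1 * f t z :=
    integrable_mul_of_bounded (h.integrable t htI) ((continuous_tent _ _).comp continuous_fst)
      fun z => by rw [abs_of_nonneg (tent_nonneg _ _ _)]; exact tent_le_one _ _ _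
  calc ∫⁻ z in {z : Phase d | ‖x - z.1‖ ≤ σ}, ENNReal.ofReal (f t z)
      ≤ ∫⁻ z in {z : Phase d | ‖x - z.1‖ ≤ σ}, ENNReal.ofReal (tent (D n) ρ z.1 * f t z) := by
        refine setLIntegral_mono' (measurableSet_le (by fun_prop) measurable_const) fun z hz => ?_
        rw [tent_eq_one hρ0, one_mul]
        have h1 : ‖D n - x‖ < σ := by rw [← dist_eq_norm, dist_comm]; exact hn
        have h2 := norm_sub_le_norm_sub_add_norm_sub (D n) x z.1
        have h3 : ‖x - z.1‖ ≤ σ := hz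
        linarith
    _ ≤ ∫⁻ z, ENNReal.ofReal (tent (D n) ρ z.1 * f t z) := setLIntegral_le_lintegral _ _
    _ = ENNReal.ofReal (∫ z, tent (D n) ρ z.1 * f t z) :=
        (ofReal_integral_eq_lintegral_ofReal h_intble (Eventually.of_forall fun z =>
          mul_nonneg (tent_nonneg _ _ _) (h.nonneg_density t z))).symm
    _ ≤ ENNReal.ofReal (36 * C * σ) := by
        refine ENNReal.ofReal_le_ofReal (hle.trans ?_)
        have h1 : (2 * (ρ:ℝ)) ^ 2 ≤ 36 * σ := by nlinarith
        calc C * (2 * (ρ:ℝ)) ^ 2 ≤ C * (36 * σ) := by gcongr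
          _ = _ := by ring

/-- The regularized field of the particles converges to that of the limit, uniformly in space and
essentially uniformly in time. -/
lemma eventually_ae_norm_truncField_sub_le (h : WeakLimit T CB X V f) {α δ τ : ℝ} (hα : 0 < α)
    (hδ : 0 < δ) (hτ : 0 < τ) :
    ∀ᶠ N in atTop, ∀ᵐ t, t ∈ Ioo 0 T → ∀ x, ‖x‖ ≤ CB →
      ‖truncField α δ (fun k => X N k t) x
        - ∫ w : Phase d, f t w • Ftrunc d α δ (x - w.1)‖ ≤ τ := by
  set L := (2+α) * δ ^ (-(1+α)) with hL
  have hL0 : 0 ≤ L := by positivity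
  let D := TopologicalSpace.denseSeq (Euc d)
  have hfi : ∀ t ∈ Icc 0 T, ∀ x, Integrable fun w : Phase d => f t w • Ftrunc d α δ (x - w.1) :=
    fun t ht x => integrable_smul_Ftrunc (h.integrable t ht) hα hδ x
  let H : ℝ × Euc d → Euc d := fun p => ∫ w : Phase d, f p.1 w • Ftrunc d α δ (p.2 - w.1)
  let G : Set ℝ := {t | t ∈ Ioo 0 T ∧ ∀ n, Tendsto
    (fun N => truncField α δ (fun k => X N k t) (D n)) atTop (nhds (H (t, D n)))}
  have hG : ∀ᵐ t, t ∈ Ioo 0 T → t ∈ G := by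
    have hae : ∀ᵐ t, ∀ p : ℕ × Fin d, t ∈ Ioo 0 T →
        Tendsto (fun N : ℕ => (N:ℝ)⁻¹ * ∑ i, Ftrunc d α δ (D p.1 - X N i t) p.2) atTop
          (nhds (∫ z : Phase d, Ftrunc d α δ (D p.1 - z.1) p.2 * f t z)) := by
      refine ae_all_iff.2 fun p => ?_
      refine h.ae_tendsto_obs_fst (ψ := fun y => Ftrunc d α δ (D p.1 - y) p.2) hL0 fun y z => ?_
      rw [← PiLp.sub_apply, ← Real.norm_eq_abs]
      refine (PiLp.norm_apply_le _ _).trans ((norm_Ftrunc_sub_le hα hδ _ _).trans_eq ?_)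
      rw [sub_sub_sub_cancel_left, norm_sub_rev]
    filter_upwards [hae] with t ht htT
    refine ⟨htT, fun n => ?_⟩
    have hk : ∀ k, Tendsto (fun N => truncField α δ (fun k => X N k t) (D n) k) atTop
        (nhds (H (t, D n) k)) := by
      intro k
      have h1 : H (t, D n) k = ∫ z : Phase d, Ftrunc d α δ (D n - z.1) k * f t z := by
        have := (EuclideanSpace.proj (𝕜 := ℝ) (ι := Fin d) k).integral_comp_comm
          (hfi t (Ioo_subset_Icc_self htT) (D n))
        simp only [H]
        refine this.symm.trans (integral_congr_ae (Eventually.of_forall fun z => ?_))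
        simp [mul_comm]
      rw [h1]
      have h2 := ht (n, k) htT
      refine h2.congr fun N => ?_
      simp [truncField]
    have := tendsto_pi_nhds.2 hk
    exact ((EuclideanSpace.equiv (Fin d) ℝ).symm.continuous.tendsto _).comp this
  let S : Set (ℝ × Euc d) := {p | p.1 ∈ G ∧ p.2 ∈ range D ∧ ‖p.2‖ < CB + 1}
  have hS : TotallyBounded S := by
    have hK : IsCompact (Icc 0 T ×ˢ closedBall (0 : Euc d) (CB + 1)) :=
      isCompact_Icc.prod (isCompact_closedBall _ _)
    refine hK.totallyBounded.subset ?_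
    rintro ⟨s, x⟩ ⟨hs, -, hx⟩
    exact ⟨Ioo_subset_Icc_self hs.1, by simpa using hx.le⟩
  have hunif := eventually_forall_dist_le_of_totallyBounded hS (L := L * (1 + CB))
    (H := fun N p => truncField α δ (fun k => X N k p.1) p.2) (H' := H)
    (mul_nonneg hL0 (by linarith [h.nonneg]))
    (by
      filter_upwards [eventually_ge_atTop 2] with N hN
      rintro ⟨s, x⟩ ⟨hs, -, -⟩ ⟨t, y⟩ ⟨ht, -, -⟩
      rw [dist_eq_norm, mul_assoc]
      refine norm_truncField_sub_le hα hδ _ _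
        (mul_nonneg (by linarith [h.nonneg]) dist_nonneg) _ _ fun k => ?_
      rw [sub_sub_sub_comm]
      refine (norm_sub_le _ _).trans ?_
      have h1 := h.move N hN k s (Ioo_subset_Icc_self hs.1) t (Ioo_subset_Icc_self ht.1)
      have h2 : ‖x - y‖ ≤ dist (s, x) (t, y) := by
        rw [← dist_eq_norm, Prod.dist_eq]; exact le_max_right _ _
      have h3 : |s - t| ≤ dist (s, x) (t, y) := by
        rw [← Real.dist_eq, Prod.dist_eq]; exact le_max_left _ _
      have h4 : CB * |s - t| ≤ CB * dist (s, x) (t, y) := by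
        have := h.nonneg
        gcongr
      simp only at *
      linarith)
    (by
      rintro ⟨s, x⟩ ⟨hs, ⟨n, rfl⟩, -⟩
      exact hs.2 n) hτ
  filter_upwards [hunif] with N hN
  filter_upwards [hG] with t htG htT x hx
  have htG := htG htT
  have hclosed : IsClosed {y | ‖truncField α δ (fun k => X N k t) y - H (t, y)‖ ≤ τ} := by
    refine isClosed_le (Continuous.norm (Continuous.sub ?_ ?_)) continuous_const
    · have h1 : Continuous fun y => ∑ k, Ftrunc d α δ (y - X N k t) :=
        continuous_finsetSum _ fun k _ =>
          (continuous_Ftrunc hδ).comp (continuous_id.sub continuous_const)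
      exact h1.const_smul (N : ℝ)⁻¹
    · refine continuous_of_dominated (bound := fun w => f t w * δ ^ (-α))
        (fun y => (hfi t (Ioo_subset_Icc_self htT) y).aestronglyMeasurable)
        (fun y => Eventually.of_forall fun w => ?_)
        ((h.integrable t (Ioo_subset_Icc_self htT)).mul_const _)
        (Eventually.of_forall fun w => ?_)
      swap
      · have h1 : Continuous fun y => Ftrunc d α δ (y - w.1) :=
          (continuous_Ftrunc hδ).comp (continuous_id.sub continuous_const)
        exact h1.const_smul (f t w)
      rw [norm_smul, Real.norm_of_nonneg (h.nonneg_density t w)]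
      exact mul_le_mul_of_nonneg_left (norm_Ftrunc_le hα hδ _) (h.nonneg_density t w)
  have hsub : ball (0 : Euc d) (CB + 1) ∩ range D ⊆
      {y | ‖truncField α δ (fun k => X N k t) y - H (t, y)‖ ≤ τ} := by
    rintro y ⟨hy, hyD⟩
    have := hN (t, y) ⟨htG, hyD, by simpa using hy⟩
    rwa [dist_eq_norm] at this
  have hxball : x ∈ ball (0 : Euc d) (CB + 1) := by
    rw [mem_ball_zero_iff]; linarith
  exact closure_minimal hsub hclosed
    ((TopologicalSpace.denseRange_denseSeq (Euc d)).open_subset_closure_inter isOpen_ball hxball)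

end WeakLimit

lemma average_nearField_le_of_card_lt {d N : ℕ} (hN : 0 < N) {q : ℕ} (hq : 1 ≤ q)
    {α β δ r₀ r₁ ε CB t : ℝ} (hα : 0 < α) (hα1 : α < 1) (hr₀ : 0 < r₀) (h01 : r₀ ≤ r₁)
    (h1δ : r₁ ≤ δ) (hMr₀ : (N:ℝ) ^ 2 * r₀ ^ q ≤ 1) (hMr₁ : 1 < (N:ℝ) * r₁ ^ q)
    (hε : 0 < ε) (hCB : 0 ≤ CB)
    {X : Fin N → ℝ → Euc d} (hX : ∀ i, ContinuousOn (X i) (Icc t (t + ε)))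
    (hsep : ∀ i j, i ≠ j → ∀ s ∈ Icc t (t + ε), X i s ≠ X j s)
    (hmove : ∀ i, ∀ s ∈ Icc t (t + ε), ‖X i s - X i t‖ ≤ CB * ε) (hεr : 2 * (CB * ε) ≤ r₀)
    (i : Fin N)
    (hdE : ∀ j, ε⁻¹ * ∫ s in t..(t + ε), ‖fieldAt (Fsing d α) X i s - fieldAt (Fsing d α) X j s‖
      / (ε ^ β + ‖X i s - X j s‖) ≤ CB)
    (hcard : ∀ r, r₁ < r → r ≤ 6 * δ →
      ((Finset.univ.filter fun j => ‖X j t - X i t‖ ≤ r).card : ℝ) < N * r) :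
    ε⁻¹ * ∫ s in t..(t + ε), ‖nearField α δ (fun k => X k s) i‖ ≤
      4 ^ q * (6 * (dyadicConst α * δ ^ (1 - α)) + CB * (ε ^ β + 5 * r₁)
        + (2+α) * δ ^ (-(1+α)) * (5 * r₁)) := by
  have hr₁ : 0 < r₁ := hr₀.trans_le h01
  have hδ : 0 < δ := hr₁.trans_le h1δ
  obtain ⟨r, hr0, hr1, hdoub, hlin⟩ := exists_doubling_scale
    (n := fun σ => ((Finset.univ.filter fun j => ‖X j t - X i t‖ ≤ σ).card : ℝ))
    (M := N) (ρ := 6 * δ) hq hr₀ h01 (by linarith) (by exact_mod_cast hN)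
    (by
      have : i ∈ Finset.univ.filter fun j => ‖X j t - X i t‖ ≤ r₀ := by simp [hr₀.le]
      exact_mod_cast Finset.card_pos.2 ⟨i, this⟩)
    hMr₀ hcard
    (fun σ => by
      have := Finset.card_filter_le (Finset.univ : Finset (Fin N)) fun j => ‖X j t - X i t‖ ≤ σ
      rw [Finset.card_univ, Fintype.card_fin] at this
      exact_mod_cast this) hMr₁
  have hdy := dyadicConst_pos hα1
  refine (average_nearField_le hN hα hα1 (hr₀.trans_le hr0) (hr1.trans h1δ) hε hCB hX hsep hmove
    (hεr.trans hr0) i hdE hdoub hlin).trans ?_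
  gcongr

lemma exists_truncation_scale {α a b c τ : ℝ} (hα1 : α < 1) (hc : 0 < c) (hτ : 0 < τ) :
    ∃ δ, 0 < δ ∧ δ ≤ c ∧ a * δ ^ (1 - α) ≤ τ ∧ b * δ ^ (1 - α) ≤ τ := by
  have h0 : Tendsto (fun δ : ℝ => δ ^ (1 - α)) (nhdsWithin 0 (Ioi 0)) (nhds 0) := by
    have := (Real.continuousAt_rpow_const 0 (1 - α) (Or.inr (by linarith))).tendsto
    rw [Real.zero_rpow (by linarith)] at this
    exact this.mono_left nhdsWithin_le_nhds
  have h1 : ∀ a : ℝ, ∀ᶠ δ : ℝ in nhdsWithin 0 (Ioi 0), a * δ ^ (1 - α) ≤ τ := fun a =>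
    (by simpa using h0.const_mul a : Tendsto (fun δ : ℝ => a * δ ^ (1 - α)) _ (nhds 0))
      |>.eventually_le_const hτ
  have h2 : ∀ᶠ δ : ℝ in nhdsWithin 0 (Ioi 0), δ ∈ Ioc 0 c := Ioc_mem_nhdsGT hc
  obtain ⟨δ, ⟨h3, h4⟩, h5, h6⟩ := (h2.and ((h1 a).and (h1 b))).exists
  exact ⟨δ, h3, h4, h5, h6⟩

lemma average_force_error_le {d N : ℕ} {α δ ε t T C τ : ℝ} (hα : 0 < α) (hα1 : α < 1) (hδ : 0 < δ)
    (hδ6 : δ ≤ 1 / 6) (hC : 0 ≤ C) (hε : 0 < ε) (ht0 : 0 ≤ t) (htT : t + ε ≤ T)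
    {X : Fin N → ℝ → Euc d} (hX : ∀ i, ContinuousOn (X i) (Icc t (t + ε)))
    (hsep : ∀ i j, i ≠ j → ∀ s ∈ Icc t (t + ε), X i s ≠ X j s) {f : ℝ → Phase d → ℝ}
    (hf : ∀ s, Measurable (f s)) (hf0 : ∀ s z, 0 ≤ f s z) (hfi : ∀ s ∈ Icc 0 T, Integrable (f s))
    (hmass : ∀ᵐ s, s ∈ Ioo 0 T → ∀ (x : Euc d) (σ : ℝ), 0 < σ → σ ≤ 1 / 6 →
      ∫⁻ z in {z : Phase d | ‖x - z.1‖ ≤ σ}, ENNReal.ofReal (f s z) ≤ ENNReal.ofReal (C * σ))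
    (i : Fin N)
    (htrunc : ∀ᵐ s, s ∈ Ioo 0 T → ‖truncField α δ (fun k => X k s) (X i s)
      - ∫ w : Phase d, f s w • Ftrunc d α δ (X i s - w.1)‖ ≤ τ) :
    ε⁻¹ * ∫ s in t..(t + ε), ‖(N : ℝ)⁻¹ • (∑ j, Fsing d α (X i s - X j s))
        - ∫ w : Phase d, f s w • Fsing d α (X i s - w.1)‖ ≤
      (ε⁻¹ * ∫ s in t..(t + ε), ‖nearField α δ (fun k => X k s) i‖)
        + τ + C * (dyadicConst α * δ ^ (1 - α)) := by
  set K := C * (dyadicConst α * δ ^ (1 - α)) with hK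
  have htε : t ≤ t + ε := by linarith
  have hnear : ContinuousOn (fun s => nearField α δ (fun k => X k s) i) (Icc t (t + ε)) := by
    simp only [nearField_eq]
    exact (continuousOn_fieldAt hX hsep i).sub (continuousOn_truncField hδ hX i)
  have hii : IntervalIntegrable (fun s => ‖nearField α δ (fun k => X k s) i‖) volume t (t + ε) :=
    hnear.norm.intervalIntegrable_of_Icc htε
  have hsum : IntervalIntegrable (fun s => ‖nearField α δ (fun k => X k s) i‖ + (τ + K)) volume
      t (t + ε) := hii.add (by simp)
  have hle : ∫ s in t..(t + ε), ‖(N : ℝ)⁻¹ • (∑ j, Fsing d α (X i s - X j s))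
        - ∫ w : Phase d, f s w • Fsing d α (X i s - w.1)‖ ≤
      ∫ s in t..(t + ε), (‖nearField α δ (fun k => X k s) i‖ + (τ + K)) := by
    rw [intervalIntegral.integral_of_le htε, intervalIntegral.integral_of_le htε,
      integral_Ioc_eq_integral_Ioo, integral_Ioc_eq_integral_Ioo]
    refine integral_mono_of_nonneg (Eventually.of_forall fun s => norm_nonneg _)
      (((intervalIntegrable_iff_integrableOn_Ioo_of_le htε).1 hsum)) ?_
    refine (ae_restrict_iff' measurableSet_Ioo).2 ?_
    filter_upwards [hmass, htrunc] with s hs1 hs2 hs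
    have hsT : s ∈ Ioo 0 T := ⟨by linarith [hs.1], by linarith [hs.2]⟩
    have h1 := norm_integral_smul_Fsing_sub_le (hf s) (hf0 s) (hfi s (Ioo_subset_Icc_self hsT))
      hα hα1 hδ hC (X i s) fun σ h0 hσ => hs1 hsT (X i s) σ h0 (hσ.trans hδ6)
    have h2 := hs2 hsT
    have h3 := nearField_eq α δ X i s
    rw [fieldAt_eq_sum] at h3
    have h4 : (N : ℝ)⁻¹ • (∑ j, Fsing d α (X i s - X j s))
        - ∫ w : Phase d, f s w • Fsing d α (X i s - w.1)
      = nearField α δ (fun k => X k s) i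
        + ((truncField α δ (fun k => X k s) (X i s)
            - ∫ w : Phase d, f s w • Ftrunc d α δ (X i s - w.1))
          - ((∫ w : Phase d, f s w • Fsing d α (X i s - w.1))
            - ∫ w : Phase d, f s w • Ftrunc d α δ (X i s - w.1))) := by
      rw [h3]; abel
    rw [h4]
    refine (norm_add_le _ _).trans ?_
    gcongr
    exact (norm_sub_le _ _).trans (add_le_add h2 h1)
  rw [intervalIntegral.integral_add hii (by simp), intervalIntegral.integral_const,
    add_sub_cancel_left, smul_eq_mul] at hle
  calc _ ≤ ε⁻¹ * ((∫ s in t..(t + ε), ‖nearField α δ (fun k => X k s) i‖) + ε * (τ + K)) := by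
        gcongr
    _ = _ := by field_simp; ring

/-- Strong convergence of the time-averaged force along trajectories (convergence
(4.6), `Fconv`): under the assumptions of Proposition 4.1, the time averages over
windows of length `ε_N` of `|F_N(s,X_i(s)) - F_∞(s,X_i(s))|`, taken uniformly over the
particles and over `t ∈ [0, T-ε_N]`, tend to `0` as `N → ∞`. -/
theorem force_strong_convergence
    (d : ℕ) (hd : 1 ≤ d) (α β T : ℝ)
    (hα : 0 < α) (hα1 : α < 1)
    (hβ : 1 < β) (hβ2 : β < min ((d:ℝ) - α) (2*(d:ℝ) - 3*α)) (hT : 0 < T)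
    (X V : (N : ℕ) → Fin N → ℝ → Euc d)
    (hsep : ∀ N, 2 ≤ N → ∀ i j : Fin N, i ≠ j → ∀ t : ℝ, 0 ≤ t → X N i t ≠ X N j t)
    (hX : ∀ N, 2 ≤ N → ∀ i : Fin N, ∀ t : ℝ, 0 ≤ t → HasDerivAt (X N i) (V N i t) t)
    (hV : ∀ N, 2 ≤ N → ∀ i : Fin N, ∀ t : ℝ, 0 ≤ t →
      HasDerivAt (V N i) (fieldAt (Fsing d α) (X N) i t) t)
    (ηs : ℕ → ℝ) (hηpos : ∀ N, 0 < ηs N) (hη0 : Tendsto ηs atTop (nhds 0))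
    (hεη : ∀ N, 2 ≤ N → epsOf (X N) ≤ ηs N)
    (CB : ℝ)
    (hbd : ∀ N, 2 ≤ N →
      Rmax (X N) T ≤ CB ∧ Kmax (V N) T ≤ CB ∧
      Ebar (Fsing d α) (X N) (epsOf (X N)) T ≤ CB ∧
      dEbar (Fsing d α) (X N) (epsOf (X N)) β T ≤ CB ∧
      ∀ t ∈ Icc (0:ℝ) T, discNorm (empMeas (X N) (V N) t) (ηs N) ≤ CB)
    -- the weak limit `f` of the empirical measures on `[0,T]`
    (f : ℝ → Phase d → ℝ) (hfmeas : ∀ t, Measurable (f t)) (hfpos : ∀ t z, 0 ≤ f t z)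
    (hfint : ∀ t ∈ Icc (0:ℝ) T, Integrable (f t) (volume : Measure (Phase d)))
    (hlim : ∀ g : ℝ × Phase d → ℝ, Continuous g → HasCompactSupport g →
      Tendsto
        (fun N => ∫ t in (0:ℝ)..T, ∫ z, g (t, z) ∂(empMeas (X N) (V N) t))
        atTop (nhds (∫ t in (0:ℝ)..T, ∫ z, g (t, z) * f t z))) :
    Tendsto
      (fun N : ℕ =>
        ⨆ (i : Fin N) (t : Icc (0:ℝ) (T - epsOf (X N))),
          (epsOf (X N))⁻¹ *
            ∫ s in (t : ℝ)..((t : ℝ) + epsOf (X N)),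
              ‖(N : ℝ)⁻¹ • (∑ j : Fin N, Fsing d α (X N i s - X N j s))
                - ∫ w : Phase d, f s w • Fsing d α (X N i s - w.1)‖)
      atTop (nhds 0) := by
  have hβ0 : 0 < β := by linarith
  have hd2 : 2 ≤ d := by
    by_contra! hcon
    have : (d:ℝ) ≤ 1 := by exact_mod_cast (by omega : d ≤ 1)
    have := lt_min_iff.1 hβ2
    linarith [this.1]
  have hcX : ∀ N, 2 ≤ N → ∀ i, ContinuousOn (X N i) (Icc 0 T) := fun N hN i t ht =>
    (hX N hN i t ht.1).continuousAt.continuousWithinAt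
  have hcV : ∀ N, 2 ≤ N → ∀ i, ContinuousOn (V N i) (Icc 0 T) := fun N hN i t ht =>
    (hV N hN i t ht.1).continuousAt.continuousWithinAt
  have hbX : ∀ N, 2 ≤ N → ∀ i, ∀ t ∈ Icc 0 T, ‖X N i t‖ ≤ CB := fun N hN i t ht =>
    le_of_iSup_Icc_le (F := fun i t => ‖X N i t‖) (fun i => bddAbove_norm_image_Icc (hcX N hN i))
      (hbd N hN).1 i ht
  have hbV : ∀ N, 2 ≤ N → ∀ i, ∀ t ∈ Icc 0 T, ‖V N i t‖ ≤ CB := fun N hN i t ht =>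
    le_of_iSup_Icc_le (F := fun i t => ‖V N i t‖) (fun i => bddAbove_norm_image_Icc (hcV N hN i))
      (hbd N hN).2.1 i ht
  have hCB : 0 ≤ CB := (norm_nonneg _).trans (hbX 2 le_rfl 0 0 ⟨le_rfl, hT.le⟩)
  have hmove : ∀ N, 2 ≤ N → ∀ i, ∀ s ∈ Icc 0 T, ∀ t ∈ Icc 0 T,
      ‖X N i s - X N i t‖ ≤ CB * |s - t| := fun N hN i s hs t ht =>
    (convex_Icc 0 T).norm_image_sub_le_of_norm_hasDerivWithin_le
      (fun u hu => (hX N hN i u hu.1).hasDerivWithinAt) (fun u hu => hbV N hN i u hu) ht hs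
  have hW : WeakLimit T CB X V f :=
    ⟨hT, hCB, hcX, hcV, hbX, hbV, hmove, hfmeas, hfpos, hfint, hlim⟩
  set C := countConst d CB with hCdef
  have hC : 0 ≤ C := by rw [hCdef]; unfold countConst; positivity
  have hcard : ∀ N, 2 ≤ N → ∀ σ, ηs N ≤ σ → σ ≤ 1 → ∀ t ∈ Icc 0 T, ∀ x : Euc d,
      ((Finset.univ.filter fun j => ‖X N j t - x‖ ≤ σ).card : ℝ) ≤ N * (C * σ ^ 2) :=
    fun N hN σ hσ hσ1 t ht x => card_ball_le hd2 (by omega) (hηpos N) (hσ.trans hσ1) hCB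
      (fun i => hbV N hN i t ht) ((hbd N hN).2.2.2.2 t ht) x hσ hσ1
  have hmass := hW.ae_mass_ball_le hC fun σ h0 h1 => by
    filter_upwards [eventually_ge_atTop 2, hη0.eventually_le_const h0] with N hN hη
      using hcard N hN σ hη h1
  have hεpos : ∀ N, 2 ≤ N → 0 < epsOf (X N) := fun N hN =>
    div_pos (Rmax_zero_pos hN fun i j hij => hsep N hN i j hij 0 le_rfl) (by positivity)
  let ρ : ℕ → ℝ := fun N => (N:ℝ) ^ (-(4 * (d:ℝ))⁻¹)
  have hdpos : (0:ℝ) < d := by positivity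
  have hρ0 : Tendsto ρ atTop (nhds 0) :=
    (tendsto_rpow_neg_atTop (by positivity)).comp tendsto_natCast_atTop_atTop
  have hερ : ∀ N, 2 ≤ N → epsOf (X N) ≤ CB * ρ N ^ 2 := by
    intro N hN
    have hN0 : (0:ℝ) < N := by positivity
    have h1 : ρ N ^ 2 = ((N:ℝ) ^ (2 * (d:ℝ))⁻¹)⁻¹ := by
      simp only [ρ]
      rw [← Real.rpow_natCast, ← Real.rpow_mul hN0.le, ← Real.rpow_neg hN0.le]
      congr 1
      field_simp
      norm_num
    rw [h1, ← div_eq_mul_inv, epsOf]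
    gcongr
    exact Rmax_zero_le hCB fun i => hbX N hN i 0 ⟨le_rfl, hT.le⟩
  have hε0 : Tendsto (fun N => epsOf (X N)) atTop (nhds 0) := by
    refine tendsto_of_tendsto_of_tendsto_of_le_of_le' tendsto_const_nhds hη0 ?_ ?_
    · filter_upwards [eventually_ge_atTop 2] with N hN using (hεpos N hN).le
    · filter_upwards [eventually_ge_atTop 2] with N hN using hεη N hN
  set q := 8 * d with hq
  have hρq : ∀ N : ℕ, 2 ≤ N → (N:ℝ) ^ 2 * ρ N ^ q ≤ 1 := by
    intro N hN
    have hN0 : (0:ℝ) < N := by positivity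
    have h1 : ρ N ^ q = ((N:ℝ) ^ 2)⁻¹ := by
      simp only [ρ]
      rw [← Real.rpow_natCast, ← Real.rpow_mul hN0.le, ← Real.rpow_natCast (N:ℝ) 2,
        ← Real.rpow_neg hN0.le]
      congr 1
      rw [hq]
      push_cast
      field_simp
      norm_num
    rw [h1, mul_inv_cancel₀ (by positivity)]
  rw [Metric.tendsto_atTop]
  intro τ hτ
  obtain ⟨δ, hδ0, hδc, hδ1, hδ2⟩ := exists_truncation_scale (τ := τ / 8)
    (a := 4 ^ q * (6 * dyadicConst α)) (b := 36 * C * dyadicConst α)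
    (c := (6 * (C + 1))⁻¹) hα1 (by positivity) (by positivity)
  have hδC : 6 * δ * (C + 1) ≤ 1 := by
    rw [← one_div, le_div_iff₀ (by positivity)] at hδc
    linarith
  have hδ6 : 6 * δ ≤ 1 := by nlinarith
  set L := (2+α) * δ ^ (-(1+α)) with hL
  have hL0 : 0 ≤ L := by positivity
  let r₁ := min δ (τ / 8 / (4 ^ q * (5 * CB + 5 * L + 1)))
  have hr₁ : 0 < r₁ := by positivity
  have hr₁δ : r₁ ≤ δ := min_le_left _ _
  have hr₁τ : 4 ^ q * (CB * (5 * r₁) + L * (5 * r₁)) ≤ τ / 8 := by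
    have h1 : r₁ * (4 ^ q * (5 * CB + 5 * L + 1)) ≤ τ / 8 :=
      (le_div_iff₀ (by positivity)).1 (min_le_right _ _)
    have h2 : (0:ℝ) ≤ r₁ * 4 ^ q := by positivity
    linarith
  have hεβ : Tendsto (fun N => 4 ^ q * (CB * epsOf (X N) ^ β)) atTop (nhds 0) := by
    have := ((hε0.rpow_const (Or.inr hβ0.le)).const_mul CB).const_mul ((4:ℝ) ^ q)
    rwa [Real.zero_rpow hβ0.ne', mul_zero, mul_zero] at this
  have hρCB : Tendsto (fun N => 2 * CB ^ 2 * ρ N) atTop (nhds 0) := by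
    simpa using hρ0.const_mul (2 * CB ^ 2)
  have hNr : ∀ᶠ N : ℕ in atTop, 1 < (N:ℝ) * r₁ ^ q :=
    (tendsto_natCast_atTop_atTop.atTop_mul_const (by positivity)).eventually_gt_atTop 1
  obtain ⟨N₀, hN₀⟩ := Filter.eventually_atTop.1
    ((eventually_ge_atTop 2).and <| (hη0.eventually_le_const hr₁).and <|
      (hε0.eventually_le_const hT).and <| (hεβ.eventually_le_const (by positivity : 0 < τ / 8)).and <|
      (hρCB.eventually_le_const one_pos).and <| (hρ0.eventually_le_const hr₁).and <| hNr.and <|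
      hW.eventually_ae_norm_truncField_sub_le hα hδ0 (by positivity : 0 < τ / 8))
  refine ⟨N₀, fun N hN => ?_⟩
  obtain ⟨hN2, hηN, hεT, hεβN, hρN, hρr, hNrN, htr⟩ := hN₀ N hN
  set ε := epsOf (X N) with hε
  have hεN : 0 < ε := hεpos N hN2
  have hN0 : 0 < N := by omega
  have hmain : ∀ (i : Fin N) (t : Icc (0:ℝ) (T - ε)), ε⁻¹ * ∫ s in (t : ℝ)..((t : ℝ) + ε),
      ‖(N : ℝ)⁻¹ • (∑ j : Fin N, Fsing d α (X N i s - X N j s))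
        - ∫ w : Phase d, f s w • Fsing d α (X N i s - w.1)‖ ≤ 5 * (τ / 8) := by
    rintro i ⟨t, ht0, htT⟩
    have htI : Icc t (t + ε) ⊆ Icc 0 T := Icc_subset_Icc ht0 (by linarith)
    have htmem : t ∈ Icc t (t + ε) := ⟨le_rfl, by linarith⟩
    have hXt : ∀ i, ContinuousOn (X N i) (Icc t (t + ε)) := fun i => (hcX N hN2 i).mono htI
    have hst : ∀ i j, i ≠ j → ∀ s ∈ Icc t (t + ε), X N i s ≠ X N j s := fun i j hij s hs =>
      hsep N hN2 i j hij s (htI hs).1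
    have herr := average_force_error_le (C := 36 * C) (τ := τ / 8) hα hα1 hδ0 (by linarith)
      (by positivity) hεN ht0 (by linarith) hXt hst hfmeas hfpos hfint hmass i (by
        filter_upwards [htr] with s hs hsT
          using hs hsT _ (hbX N hN2 i s (Ioo_subset_Icc_self hsT)))
    have hρpos : 0 < ρ N := by positivity
    have hnear := average_nearField_le_of_card_lt hN0 (q := q) (by omega) (β := β) hα hα1 hρpos
      hρr hr₁δ (hρq N hN2) hNrN hεN hCB hXt hst
      (fun j s hs => by
        refine (hmove N hN2 j s (htI hs) t (htI htmem)).trans ?_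
        gcongr
        rw [abs_of_nonneg (by linarith [hs.1])]
        linarith [hs.2])
      (by
        have h1 : CB * ε ≤ CB * (CB * ρ N ^ 2) := by gcongr; exact hερ N hN2
        nlinarith)
      i
      (fun j => average_le_of_dEbar_le hεN hεT (hcX N hN2)
        (fun i j hij s hs => hsep N hN2 i j hij s hs.1) hCB (hbd N hN2).2.2.2.1 i j ⟨ht0, htT⟩)
      (fun r hr hrδ => by
        have hr0 : 0 < r := hr₁.trans hr
        refine (hcard N hN2 r (hηN.trans hr.le) (by linarith) t (htI htmem) _).trans_lt ?_
        have h2 : r * (C + 1) ≤ 1 :=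
          (mul_le_mul_of_nonneg_right hrδ (by linarith)).trans hδC
        have h3 : C * r < 1 := by nlinarith
        have h1 : C * r ^ 2 < r := by
          calc C * r ^ 2 = (C * r) * r := by ring
            _ < 1 * r := mul_lt_mul_of_pos_right h3 hr0
            _ = r := one_mul r
        have : (0:ℝ) < N := by exact_mod_cast hN0
        gcongr)
    simp only
    linarith
  have h0 : ∀ (i : Fin N) (t : Icc (0:ℝ) (T - ε)), 0 ≤ ε⁻¹ * ∫ s in (t : ℝ)..((t : ℝ) + ε),
      ‖(N : ℝ)⁻¹ • (∑ j : Fin N, Fsing d α (X N i s - X N j s))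
        - ∫ w : Phase d, f s w • Fsing d α (X N i s - w.1)‖ := fun i t =>
    mul_nonneg (inv_nonneg.2 hεN.le)
      (intervalIntegral.integral_nonneg (by linarith) fun s _ => norm_nonneg _)
  rw [Real.dist_eq, sub_zero, abs_of_nonneg (Real.iSup_nonneg fun i => Real.iSup_nonneg (h0 i))]
  refine (Real.iSup_le (fun i => Real.iSup_le (hmain i) (by positivity))
    (by positivity)).trans_lt ?_
  linarith

end
end

section
/- Testing a measure against a smooth function via the discrete L^∞ norm (step in Proposition 4.1): There is a constant C_d depending only on d (one may take C_d = √(2d)) such that for every probability measure μ on ℝ^{2d}, every η > 0, and every compactly supported C¹ function φ : ℝ^{2d} → ℝ, one has ∫ φ dμ ≤ ‖μ‖_{∞,η} ‖φ‖_{L¹} + C_d η ‖∇φ‖_{L^∞}. -/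
open MeasureTheory Set

noncomputable section

private lemma volume_euc_cube {d : ℕ} (x : Euc d) {η : ℝ} (hη : 0 ≤ η) :
    volume {p : Euc d | ∀ k, |p k - x k| ≤ η} = ENNReal.ofReal ((2 * η) ^ d) := by
  have hset : {p : Euc d | ∀ k, |p k - x k| ≤ η} =
      WithLp.ofLp ⁻¹' Metric.closedBall (WithLp.ofLp x) η := by
    ext p
    simp [dist_pi_le_iff hη, Real.dist_eq]
  rw [hset, (PiLp.volume_preserving_ofLp (Fin d)).measure_preimage
    Metric.isClosed_closedBall.measurableSet.nullMeasurableSet,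
    Real.volume_pi_closedBall _ hη, Fintype.card_fin]

/-- A coordinatewise sup-norm ball of radius `η` in `ℝ^{2d}` has volume `(2η)^{2d}`. -/
lemma volume_Binf {d : ℕ} (z : Phase d) {η : ℝ} (hη : 0 ≤ η) :
    volume.real (Binf z η) = (2 * η) ^ (2 * d) := by
  have hset : Binf z η = {p : Euc d | ∀ k, |p k - z.1 k| ≤ η} ×ˢ
      {p : Euc d | ∀ k, |p k - z.2 k| ≤ η} := rfl
  rw [Measure.real, hset, Measure.volume_eq_prod, Measure.prod_prod, volume_euc_cube _ hη,
    volume_euc_cube _ hη, ENNReal.toReal_mul, ENNReal.toReal_ofReal (by positivity), two_mul d,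
    pow_add]

lemma isClosed_setOf_mem_Binf (d : ℕ) (η : ℝ) :
    IsClosed {p : Phase d × Phase d | p.2 ∈ Binf p.1 η} := by
  have hset : {p : Phase d × Phase d | p.2 ∈ Binf p.1 η} =
      (⋂ k, {p | |p.2.1 k - p.1.1 k| ≤ η}) ∩ ⋂ k, {p | |p.2.2 k - p.1.2 k| ≤ η} := by
    ext p
    simp [Binf]
  rw [hset]
  exact (isClosed_iInter fun k => isClosed_le (by fun_prop) continuous_const).inter
    (isClosed_iInter fun k => isClosed_le (by fun_prop) continuous_const)

lemma measurableSet_Binf {d : ℕ} (z : Phase d) (η : ℝ) : MeasurableSet (Binf z η) :=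
  ((isClosed_setOf_mem_Binf d η).preimage
    (by fun_prop : Continuous fun w : Phase d => (z, w))).measurableSet

lemma mem_Binf_comm {d : ℕ} {z w : Phase d} {η : ℝ} : w ∈ Binf z η ↔ z ∈ Binf w η := by
  simp only [Binf, mem_ofPred_eq, abs_sub_comm]

lemma norm_le_sqrt_mul_of_abs_le {d : ℕ} {x : Euc d} {η : ℝ} (hη : 0 ≤ η)
    (h : ∀ k, |x k| ≤ η) : ‖x‖ ≤ Real.sqrt d * η := by
  rw [EuclideanSpace.norm_eq]
  refine Real.sqrt_le_iff.2 ⟨by positivity, ?_⟩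
  calc ∑ k, ‖x k‖ ^ 2 ≤ ∑ _k : Fin d, η ^ 2 := by
        gcongr with k
        exact h k
    _ = (Real.sqrt d * η) ^ 2 := by
        rw [mul_pow, Real.sq_sqrt (Nat.cast_nonneg d)]
        simp

lemma norm_sub_le_of_mem_Binf {d : ℕ} {z w : Phase d} {η : ℝ} (hη : 0 ≤ η)
    (h : w ∈ Binf z η) : ‖w - z‖ ≤ Real.sqrt (2 * d) * η := by
  have hd : Real.sqrt d * η ≤ Real.sqrt (2 * d) * η := by
    gcongr
    linarith [Nat.cast_nonneg (α := ℝ) d]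
  exact (norm_prod_le_iff.2 ⟨norm_le_sqrt_mul_of_abs_le hη (by simpa using h.1),
    norm_le_sqrt_mul_of_abs_le hη (by simpa using h.2)⟩).trans hd

/-- The oscillation of a compactly supported `C¹` function over a cube. -/
lemma le_abs_add_of_mem_Binf {d : ℕ} {η : ℝ} (hη : 0 ≤ η) {φ : Phase d → ℝ}
    (hφ : ContDiff ℝ 1 φ) (hsupp : HasCompactSupport φ) {z w : Phase d} (h : w ∈ Binf z η) :
    φ z ≤ |φ w| + Real.sqrt (2 * (d : ℝ)) * η * ⨆ z : Phase d, ‖fderiv ℝ φ z‖ := by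
  have hbdd : BddAbove (range fun z => ‖fderiv ℝ φ z‖) :=
    (hφ.continuous_fderiv one_ne_zero).norm.bddAbove_range_of_hasCompactSupport
      (hsupp.fderiv ℝ).norm
  have hM := le_ciSup hbdd
  have hmv := convex_univ.norm_image_sub_le_of_norm_fderiv_le
    (fun x _ => hφ.differentiable one_ne_zero x) (fun x _ => hM x) (mem_univ w) (mem_univ z)
  have hdist := norm_sub_le_of_mem_Binf hη h
  rw [norm_sub_rev] at hdist
  have hmul := mul_le_mul_of_nonneg_left hdist ((norm_nonneg _).trans (hM z))
  have habs := (le_abs_self _).trans (hmv.trans hmul)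
  linarith [le_abs_self (φ w), mul_comm (⨆ z, ‖fderiv ℝ φ z‖) (Real.sqrt (2 * d) * η)]

/-- Bound of the `μ`-average of the integrals of `|f|` over the cubes centred at `z`. -/
lemma integral_setIntegral_Binf_le {d : ℕ} (μ : Measure (Phase d)) [IsProbabilityMeasure μ]
    (η : ℝ) {f : Phase d → ℝ} (hf : Integrable f) :
    Integrable (fun z => ∫ w in Binf z η, |f w|) μ ∧
    ∫ z, (∫ w in Binf z η, |f w|) ∂μ ≤
      (⨆ z : Phase d, (μ (Binf z η)).toReal) * ∫ w, |f w| := by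
  have hind : ∀ z, ∫ w in Binf z η, |f w| = ∫ w, {p : Phase d × Phase d |
      p.2 ∈ Binf p.1 η}.indicator (fun p => |f p.2|) (z, w) := fun z => by
    rw [← integral_indicator (measurableSet_Binf z η)]
    rfl
  have hint : Integrable ({p : Phase d × Phase d |
      p.2 ∈ Binf p.1 η}.indicator (fun p => |f p.2|)) (μ.prod volume) :=
    (hf.abs.comp_snd μ).indicator (isClosed_setOf_mem_Binf d η).measurableSet
  simp only [hind]
  refine ⟨hint.integral_prod_left, ?_⟩
  have hswap := integral_integral_swap (f := fun z w => {p : Phase d × Phase d |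
      p.2 ∈ Binf p.1 η}.indicator (fun p => |f p.2|) (z, w)) hint
  rw [hswap, ← integral_const_mul]
  refine integral_mono hint.integral_prod_right (hf.abs.const_mul _) fun w => ?_
  have hslice : (fun z => {p : Phase d × Phase d |
      p.2 ∈ Binf p.1 η}.indicator (fun p => |f p.2|) (z, w)) =
      (Binf w η).indicator fun _ => |f w| := by
    funext z
    by_cases h : z ∈ Binf w η
    · rw [indicator_of_mem h]
      exact indicator_of_mem (a := (z, w)) (mem_Binf_comm.1 h) _
    · rw [indicator_of_notMem h]
      exact indicator_of_notMem (a := (z, w)) (mt mem_Binf_comm.1 h) _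
  have hbdd : BddAbove (range fun z => (μ (Binf z η)).toReal) :=
    ⟨1, by rintro _ ⟨z, rfl⟩; exact measureReal_le_one⟩
  beta_reduce
  rw [hslice, integral_indicator_const _ (measurableSet_Binf w η), smul_eq_mul]
  exact mul_le_mul_of_nonneg_right (le_ciSup hbdd w) (abs_nonneg _)

/-- Testing a measure against a smooth function via the discrete `L^∞` norm (step in
Proposition 4.1): for every probability measure `μ`, every `η > 0` and every compactly
supported `C¹` function `φ`,
`∫ φ dμ ≤ ‖μ‖_{∞,η} ‖φ‖_{L¹} + √(2d) η ‖∇φ‖_{L^∞}`. -/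
theorem test_against_discNorm
    (d : ℕ) (hd : 1 ≤ d) (μ : Measure (Phase d)) [IsProbabilityMeasure μ]
    (η : ℝ) (hη : 0 < η)
    (φ : Phase d → ℝ) (hφ : ContDiff ℝ 1 φ) (hsupp : HasCompactSupport φ) :
    ∫ z, φ z ∂μ ≤
      discNorm μ η * (∫ z, |φ z|) +
        Real.sqrt (2*(d:ℝ)) * η * ⨆ z : Phase d, ‖fderiv ℝ φ z‖ := by
  have hint : Integrable φ := hφ.continuous.integrable_of_hasCompactSupport hsupp
  have hintμ : Integrable φ μ := hφ.continuous.integrable_of_hasCompactSupport hsupp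
  set c := Real.sqrt (2*(d:ℝ)) * η * ⨆ z : Phase d, ‖fderiv ℝ φ z‖
  have hm : 0 < (2 * η) ^ (2 * d) := by positivity
  obtain ⟨hF, hFle⟩ := integral_setIntegral_Binf_le μ η hint
  have hpoint : ∀ z, φ z ≤ ((2 * η) ^ (2 * d))⁻¹ * (∫ w in Binf z η, |φ w|) + c := fun z => by
    have hvol := volume_Binf z hη.le
    have hfin : volume (Binf z η) ≠ ⊤ := fun h => by simp [Measure.real, h] at hvol; simp_all
    have hconst : ∀ a : ℝ, IntegrableOn (fun _ => a) (Binf z η) :=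
      fun a => integrableOn_const hfin
    have hmono := setIntegral_mono_on (hconst (φ z)) (hint.abs.integrableOn.add (hconst c))
      (measurableSet_Binf z η) fun w hw => le_abs_add_of_mem_Binf hη.le hφ hsupp hw
    simp only [Pi.add_apply] at hmono
    rw [integral_add hint.abs.integrableOn (hconst c), setIntegral_const, setIntegral_const,
      hvol, smul_eq_mul, smul_eq_mul] at hmono
    rw [← mul_le_mul_iff_right₀ hm, mul_add, mul_inv_cancel_left₀ hm.ne']
    exact hmono
  calc ∫ z, φ z ∂μ
      ≤ ∫ z, (((2 * η) ^ (2 * d))⁻¹ * (∫ w in Binf z η, |φ w|) + c) ∂μ :=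
        integral_mono hintμ ((hF.const_mul _).add (integrable_const c)) hpoint
    _ = ((2 * η) ^ (2 * d))⁻¹ * (∫ z, (∫ w in Binf z η, |φ w|) ∂μ) + c := by
        rw [integral_add (hF.const_mul _) (integrable_const c), integral_const_mul]
        simp
    _ ≤ discNorm μ η * (∫ z, |φ z|) + c := by
        rw [discNorm, mul_assoc]
        gcongr

end
end
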